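/- arXiv:0712.1275 — 2 statements merged into one kernel-verified Lean document; each statement's English description precedes it below -/
import Mathlib

section
/- Almost surely, ω does not have a non-zero derivative anywhere; that is, the set of ω ∈ Ω for which there exists t ∈ [0,∞) such that the derivative ω′(t) exists (one-sided at t = 0) and is non-zero is null. -/
open Filter Topology MeasureTheory
open scoped ENNReal NNReal

namespace GTP

/-- The sample space `Ω`: all continuous functions `ω : [0,∞) → ℝ`. -/
def Omega : Type := {f : ℝ≥0 → ℝ // Continuous f}

/-- The filtration: `F t` is the smallest σ-algebra on `Ω` making all maps
`ω ↦ ω s`, `s ∈ [0,t]`, measurable. -/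
def F (t : ℝ≥0) : MeasurableSpace Omega :=
  ⨆ s : {s : ℝ≥0 // s ≤ t},
    MeasurableSpace.comap (fun ω : Omega => ω.1 s.1) inferInstance

/-- A stopping time relative to the filtration `(F t)`, with values in `[0,∞]`. -/
def IsStopping (τ : Omega → ℝ≥0∞) : Prop :=
  ∀ t : ℝ≥0, MeasurableSet[F t] {ω : Omega | τ ω ≤ (t : ℝ≥0∞)}

/-- `F_τ`-measurability of a function `h : Ω → ℝ`. -/
def MeasurableAtTime (τ : Omega → ℝ≥0∞) (h : Omega → ℝ) : Prop :=
  ∀ B : Set ℝ, MeasurableSet B → ∀ t : ℝ≥0,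
    MeasurableSet[F t] (h ⁻¹' B ∩ {ω : Omega | τ ω ≤ (t : ℝ≥0∞)})

/-- An elementary trading strategy: an increasing sequence of stopping times
`τ₁ ≤ τ₂ ≤ ⋯` tending to `∞`, together with bounded `F_{τ_n}`-measurable
portfolio functions `h_n`. -/
structure ElemStrategy where
  τ : ℕ → Omega → ℝ≥0∞
  stopping : ∀ n, IsStopping (τ n)
  mono : ∀ n ω, τ n ω ≤ τ (n + 1) ω
  tendsto_top : ∀ ω, Tendsto (fun n => τ n ω) atTop (𝓝 ⊤)
  h : ℕ → Omega → ℝ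
  h_bdd : ∀ n, ∃ C : ℝ, ∀ ω, |h n ω| ≤ C
  h_meas : ∀ n, MeasurableAtTime (τ n) (h n)

/-- The time `τ ∧ t` as an element of `[0,∞)`. -/
noncomputable def clip (τ : Omega → ℝ≥0∞) (t : ℝ≥0) (ω : Omega) : ℝ≥0 :=
  (min (τ ω) (t : ℝ≥0∞)).toNNReal

/-- The elementary capital process
`K_t(ω) := c + Σ_n h_n(ω) (ω(τ_{n+1} ∧ t) − ω(τ_n ∧ t))`. -/
noncomputable def elemCapital (G : ElemStrategy) (c : ℝ) (t : ℝ≥0) (ω : Omega) : ℝ :=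
  c + ∑' n : ℕ, G.h n ω * (ω.1 (clip (G.τ (n + 1)) t ω) - ω.1 (clip (G.τ n) t ω))

/-- A positive capital process: a countable sum of nonnegative elementary capital
processes with strictly positive summable initial capitals. -/
structure PosCapital where
  G : ℕ → ElemStrategy
  c : ℕ → ℝ
  c_pos : ∀ n, 0 < c n
  c_summable : Summable c
  nonneg : ∀ n t ω, 0 ≤ elemCapital (G n) (c n) t ω

/-- The value `S_t(ω) ∈ [0,∞]` of a positive capital process. -/
noncomputable def PosCapital.value (S : PosCapital) (t : ℝ≥0) (ω : Omega) : ℝ≥0∞ :=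
  ∑' n : ℕ, ENNReal.ofReal (elemCapital (S.G n) (S.c n) t ω)

/-- The initial value `S_0` of a positive capital process (independent of `ω`,
since `K^{G_n,c_n}_0 = c_n`). -/
noncomputable def PosCapital.init (S : PosCapital) : ℝ≥0∞ :=
  ∑' n : ℕ, ENNReal.ofReal (S.c n)

/-- Upper probability:
`UpProb(E) := inf { S₀ : S a positive capital process, liminf_{t→∞} S_t ≥ 1_E }`. -/
noncomputable def UpProb (E : Set Omega) : ℝ≥0∞ :=
  ⨅ (S : PosCapital) (_ : ∀ ω : Omega,
      E.indicator (fun _ => (1 : ℝ≥0∞)) ω ≤ liminf (fun t : ℝ≥0 => S.value t ω) atTop),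
    S.init

/-- A set is null if its upper probability is `0`. -/
def IsNull (E : Set Omega) : Prop := UpProb E = 0

/-- `ω` has derivative `L` at `t ∈ [0,∞)` (one-sided at `t = 0`): the difference
quotients converge to `L` as `s → t`, `s ≠ t`, within `[0,∞)`. -/
def HasDerivAtTime (ω : Omega) (t : ℝ≥0) (L : ℝ) : Prop :=
  Tendsto (fun s : ℝ≥0 => (ω.1 s - ω.1 t) / ((s : ℝ) - (t : ℝ))) (𝓝[≠] t) (𝓝 L)

/-! ### Discrete part: betting on an integer-valued walk -/

/-- Running maximum. -/
def rmax (Y : ℕ → ℤ) : ℕ → ℤ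
  | 0 => Y 0
  | n + 1 => max (rmax Y n) (Y (n + 1))

/-- The increment of `x ↦ x ^ 3`. -/
def cub (x : ℤ) : ℤ := 3 * x ^ 2 + 3 * x + 1

/-- Discrete Azema-Yor capital, with clamping. -/
def vcap (Y : ℕ → ℤ) : ℕ → ℤ
  | 0 => 8000
  | n + 1 => vcap Y n +
      (if cub (rmax Y n) ≤ vcap Y n then cub (rmax Y n) else 0) * (Y (n + 1) - Y n)

def vstake (Y : ℕ → ℤ) (n : ℕ) : ℤ :=
  if cub (rmax Y n) ≤ vcap Y n then cub (rmax Y n) else 0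

lemma vcap_succ (Y : ℕ → ℤ) (n : ℕ) :
    vcap Y (n + 1) = vcap Y n + vstake Y n * (Y (n + 1) - Y n) := rfl

lemma cub_pos (x : ℤ) : 0 < cub x := by
  unfold cub; nlinarith [sq_nonneg (2 * x + 1)]

lemma vstake_nonneg (Y : ℕ → ℤ) (n : ℕ) : 0 ≤ vstake Y n := by
  unfold vstake; split_ifs
  · exact (cub_pos _).le
  · exact le_rfl

lemma vcap_nonneg (Y : ℕ → ℤ) (n : ℕ)
    (hY : ∀ j < n, Y (j + 1) - Y j = 1 ∨ Y (j + 1) - Y j = -1) :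
    0 ≤ vcap Y n ∧ vstake Y n ≤ vcap Y n := by
  have key : 0 ≤ vcap Y n → vstake Y n ≤ vcap Y n := by
    intro h; unfold vstake; split_ifs with h1
    · exact h1
    · exact h
  suffices h : 0 ≤ vcap Y n from ⟨h, key h⟩
  clear key
  induction n with
  | zero => simp [vcap]
  | succ n ih =>
    have h0 := ih (fun j hj => hY j (by omega))
    have h1 : vstake Y n ≤ vcap Y n := by
      unfold vstake; split_ifs with h1
      · exact h1
      · exact h0
    have h2 := vstake_nonneg Y n
    rw [vcap_succ]
    rcases hY n (by omega) with h | h <;> rw [h] <;> linarith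

lemma le_rmax (Y : ℕ → ℤ) (n : ℕ) : Y n ≤ rmax Y n := by
  cases n <;> simp [rmax]

lemma rmax_ge_zero (Y : ℕ → ℤ) (n : ℕ) : Y 0 ≤ rmax Y n := by
  induction n with
  | zero => simp [rmax]
  | succ n ih => exact ih.trans (le_max_left _ _)

lemma rmax_attained (Y : ℕ → ℤ) (n : ℕ) : ∃ j ≤ n, rmax Y n = Y j := by
  induction n with
  | zero => exact ⟨0, le_rfl, rfl⟩
  | succ n ih =>
    obtain ⟨j, hj, h⟩ := ih
    rcases max_choice (rmax Y n) (Y (n + 1)) with h1 | h1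
    · exact ⟨j, by omega, by rw [rmax, h1, h]⟩
    · exact ⟨n + 1, le_rfl, by rw [rmax, h1]⟩

lemma vcap_good_aux (M X V : ℤ) (hM : 20 ≤ M) (hV : V = M ^ 3 - cub M * (M - X))
    (hD : 7 * (M - X + 1) ≤ M) : cub M ≤ V ∧ M ^ 3 ≤ 2 * V := by
  have hc : 2 * cub M ≤ 7 * M ^ 2 := by unfold cub; nlinarith
  have hp := cub_pos M
  have h1 : cub M * (7 * (M - X + 1)) ≤ cub M * M := mul_le_mul_of_nonneg_left hD hp.le
  have h2 : (2 * cub M) * M ≤ (7 * M ^ 2) * M := mul_le_mul_of_nonneg_right hc (by linarith)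
  constructor <;> nlinarith

/-- Along a path with small relative drawdown the capital grows cubically. -/
lemma vcap_good (Y : ℕ → ℤ) (n : ℕ) (h0 : Y 0 = 20)
    (hY : ∀ j < n, Y (j + 1) - Y j = 1 ∨ Y (j + 1) - Y j = -1)
    (hD : ∀ j l, j ≤ l → l ≤ n → 7 * (Y j - Y l + 1) ≤ Y j) :
    vcap Y n = rmax Y n ^ 3 - cub (rmax Y n) * (rmax Y n - Y n) := by
  induction n with
  | zero => simp [vcap, rmax, h0]
  | succ n ih =>
    have ih' := ih (fun j hj => hY j (by omega)) (fun j l h1 h2 => hD j l h1 (by omega))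
    obtain ⟨j, hj, hjm⟩ := rmax_attained Y n
    have hd := hD j n hj (by omega)
    rw [← hjm] at hd
    have hM : 20 ≤ rmax Y n := h0 ▸ rmax_ge_zero Y n
    have h1 := (vcap_good_aux _ _ _ hM ih' hd).1
    have h2 := le_rmax Y n
    rw [vcap_succ, vstake, if_pos h1, ih']
    rcases h2.lt_or_eq with h3 | h3
    · have : rmax Y (n + 1) = rmax Y n := by
        rw [rmax]; apply max_eq_left
        rcases hY n (by omega) with h | h <;> omega
      rw [this]; ring
    · rcases hY n (by omega) with h | h
      · have : rmax Y (n + 1) = rmax Y n + 1 := by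
          rw [rmax, ← h3, max_eq_right] <;> omega
        have h4 : Y (n + 1) = Y n + 1 := by omega
        rw [this, h4, ← h3]; unfold cub; ring
      · have : rmax Y (n + 1) = rmax Y n := by
          rw [rmax, ← h3, max_eq_left]; omega
        rw [this]; ring

lemma vcap_big (Y : ℕ → ℤ) (n : ℕ) (h0 : Y 0 = 20)
    (hY : ∀ j < n, Y (j + 1) - Y j = 1 ∨ Y (j + 1) - Y j = -1)
    (hD : ∀ j l, j ≤ l → l ≤ n → 7 * (Y j - Y l + 1) ≤ Y j) :
    Y n ^ 3 ≤ 2 * vcap Y n := by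
  obtain ⟨j, hj, hjm⟩ := rmax_attained Y n
  have hd := hD j n hj le_rfl
  rw [← hjm] at hd
  have hM : 20 ≤ rmax Y n := h0 ▸ rmax_ge_zero Y n
  have h1 := (vcap_good_aux _ _ _ hM (vcap_good Y n h0 hY hD) hd).2
  have h2 := le_rmax Y n
  refine le_trans ?_ h1
  have : Odd 3 := by decide
  exact (Odd.strictMono_pow this).monotone h2

/-- The walk seen from index `i`, started at `20`. -/
def shft (Z : ℕ → ℤ) (i : ℕ) : ℕ → ℤ := fun d => Z (i + d) - Z i + 20

/-- Unclamped stake. -/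
def gstake (Z : ℕ → ℤ) (n : ℕ) : ℤ :=
  -(2 * 8000 * Z n) + ∑ i ∈ Finset.range (n + 1), vstake (shft Z i) (n - i)

/-- Clamped capital, initial capital `8000 * (R ^ 2 + 1)`, stopped at `T`. -/
def wcap (R T : ℤ) (Z : ℕ → ℤ) : ℕ → ℤ
  | 0 => 8000 * (R ^ 2 + 1)
  | n + 1 => wcap R T Z n +
      (if |gstake Z n| ≤ wcap R T Z n ∧ wcap R T Z n < T then gstake Z n else 0)
        * (Z (n + 1) - Z n)

def wstake (R T : ℤ) (Z : ℕ → ℤ) (n : ℕ) : ℤ :=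
  if |gstake Z n| ≤ wcap R T Z n ∧ wcap R T Z n < T then gstake Z n else 0

lemma wcap_succ (R T : ℤ) (Z : ℕ → ℤ) (n : ℕ) :
    wcap R T Z (n + 1) = wcap R T Z n + wstake R T Z n * (Z (n + 1) - Z n) := rfl

lemma wstake_le (R T : ℤ) (Z : ℕ → ℤ) (n : ℕ) (hT : 0 ≤ T) : |wstake R T Z n| ≤ T := by
  unfold wstake; split_ifs with h
  · linarith [h.1, h.2]
  · simpa using hT

lemma wstake_eq_zero (R T : ℤ) (Z : ℕ → ℤ) (n : ℕ) (h : T ≤ wcap R T Z n) :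
    wstake R T Z n = 0 := by
  unfold wstake; rw [if_neg]; intro h1; linarith [h1.2]

lemma wcap_stable (R T : ℤ) (Z : ℕ → ℤ) (n d : ℕ) (h : T ≤ wcap R T Z n) :
    T ≤ wcap R T Z (n + d) := by
  induction d with
  | zero => exact h
  | succ d ih => rw [← add_assoc, wcap_succ, wstake_eq_zero _ _ _ _ ih]; simpa using ih

lemma wcap_nonneg (R T : ℤ) (Z : ℕ → ℤ) (n : ℕ)
    (hZ : ∀ j < n, Z (j + 1) - Z j = 1 ∨ Z (j + 1) - Z j = -1) :
    0 ≤ wcap R T Z n ∧ |wstake R T Z n| ≤ wcap R T Z n := by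
  have key : ∀ n, 0 ≤ wcap R T Z n → |wstake R T Z n| ≤ wcap R T Z n := by
    intro n h; unfold wstake; split_ifs with h1
    · exact h1.1
    · simpa using h
  suffices h : 0 ≤ wcap R T Z n from ⟨h, key n h⟩
  induction n with
  | zero => simp only [wcap]; positivity
  | succ n ih =>
    have h1 := key n (ih (fun j hj => hZ j (by omega)))
    rw [abs_le] at h1
    rw [wcap_succ]
    rcases hZ n (by omega) with h | h <;> rw [h] <;> linarith

lemma wcap_formula (R T : ℤ) (Z : ℕ → ℤ) (n : ℕ) (h0 : Z 0 = 0)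
    (hZ : ∀ j < n, Z (j + 1) - Z j = 1 ∨ Z (j + 1) - Z j = -1)
    (hR : ∀ j < n, |Z j| < R) (hT : ∀ j < n, wcap R T Z j < T) :
    wcap R T Z n = 8000 * (R ^ 2 - Z n ^ 2)
      + ∑ i ∈ Finset.range (n + 1), vcap (shft Z i) (n - i) := by
  induction n with
  | zero => simp [wcap, h0, vcap]; ring
  | succ n ih =>
    have ih' := ih (fun j hj => hZ j (by omega)) (fun j hj => hR j (by omega))
      (fun j hj => hT j (by omega))
    have hv : ∀ i ∈ Finset.range (n + 1), 0 ≤ vcap (shft Z i) (n - i) ∧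
        vstake (shft Z i) (n - i) ≤ vcap (shft Z i) (n - i) := by
      intro i hi
      rw [Finset.mem_range] at hi
      apply vcap_nonneg
      intro j hj
      have := hZ (i + j) (by omega)
      simpa [shft, add_assoc] using this
    have hs1 : ∑ i ∈ Finset.range (n + 1), vstake (shft Z i) (n - i)
        ≤ ∑ i ∈ Finset.range (n + 1), vcap (shft Z i) (n - i) :=
      Finset.sum_le_sum fun i hi => (hv i hi).2
    have hs0 : 0 ≤ ∑ i ∈ Finset.range (n + 1), vstake (shft Z i) (n - i) :=
      Finset.sum_nonneg fun i hi => vstake_nonneg _ _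
    have hRn := hR n (by omega)
    rw [abs_lt] at hRn
    have hst : wstake R T Z n = gstake Z n := by
      unfold wstake
      rw [if_pos]
      refine ⟨?_, hT n (by omega)⟩
      rw [ih', abs_le]
      unfold gstake
      constructor <;> nlinarith
    have hsum : ∑ i ∈ Finset.range (n + 1 + 1), vcap (shft Z i) (n + 1 - i)
        = ∑ i ∈ Finset.range (n + 1), vcap (shft Z i) (n - i)
          + (∑ i ∈ Finset.range (n + 1), vstake (shft Z i) (n - i)) * (Z (n + 1) - Z n)
          + 8000 := by
      rw [Finset.sum_range_succ, Finset.sum_mul, ← Finset.sum_add_distrib]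
      congr 1
      · apply Finset.sum_congr rfl
        intro i hi
        rw [Finset.mem_range] at hi
        have : n + 1 - i = (n - i) + 1 := by omega
        rw [this, vcap_succ]
        have h3 : i + (n - i + 1) = n + 1 := by omega
        have h4 : i + (n - i) = n := by omega
        simp only [shft, h3, h4]
        ring
      · simp [vcap]
    rw [wcap_succ, hst, ih', hsum]
    unfold gstake
    have hsq : (Z (n + 1) - Z n) ^ 2 = 1 := by
      rcases hZ n (by omega) with h | h <;> rw [h] <;> norm_num
    have : Z (n + 1) ^ 2 = Z n ^ 2 + 2 * Z n * (Z (n + 1) - Z n) + 1 := by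
      rw [← hsq]; ring
    rw [this]; ring

/-- If the walk has a stretch with small drawdowns, the target `T` is reached. -/
lemma wcap_reaches (R T : ℤ) (Z : ℕ → ℤ) (i n : ℕ) (hin : i ≤ n) (h0 : Z 0 = 0)
    (hZ : ∀ j < n, Z (j + 1) - Z j = 1 ∨ Z (j + 1) - Z j = -1)
    (hR : ∀ j ≤ n, |Z j| < R)
    (hD : ∀ j l, i ≤ j → j ≤ l → l ≤ n → 7 * (Z j - Z l + 1) ≤ Z j - Z i + 20)
    (hT : 2 * T ≤ (Z n - Z i + 20) ^ 3) :
    ∃ j ≤ n, T ≤ wcap R T Z j := by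
  by_contra! hcon
  have hf := wcap_formula R T Z n h0 hZ (fun j hj => hR j hj.le) (fun j hj => hcon j hj.le)
  have hv : ∀ i ∈ Finset.range (n + 1), 0 ≤ vcap (shft Z i) (n - i) := by
    intro i hi
    rw [Finset.mem_range] at hi
    refine (vcap_nonneg _ _ ?_).1
    intro j hj
    have := hZ (i + j) (by omega)
    simpa [shft, add_assoc] using this
  have h1 := Finset.single_le_sum hv (Finset.mem_range.2 (by omega : i < n + 1))
  have h2 : shft Z i (n - i) ^ 3 ≤ 2 * vcap (shft Z i) (n - i) := by
    apply vcap_big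
    · simp [shft]
    · intro j hj
      have := hZ (i + j) (by omega)
      simpa [shft, add_assoc] using this
    · intro j l hjl hl
      have := hD (i + j) (i + l) (by omega) (by omega) (by omega)
      simp only [shft]; linarith
  have h3 : shft Z i (n - i) = Z n - Z i + 20 := by
    simp only [shft]; rw [show i + (n - i) = n by omega]
  rw [h3] at h2
  have h4 := hcon n le_rfl
  have h5 := abs_lt.1 (hR n le_rfl)
  have h6 : 0 ≤ R ^ 2 - Z n ^ 2 := by nlinarith
  linarith

/-- The stake depends only on the first `n + 1` values of the walk. -/
lemma rmax_congr {Y Y' : ℕ → ℤ} {n : ℕ} (h : ∀ j ≤ n, Y j = Y' j) : rmax Y n = rmax Y' n := by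
  induction n with
  | zero => exact h 0 le_rfl
  | succ n ih => rw [rmax, rmax, ih (fun j hj => h j (by omega)), h (n + 1) le_rfl]

lemma vcap_congr {Y Y' : ℕ → ℤ} {n : ℕ} (h : ∀ j ≤ n, Y j = Y' j) : vcap Y n = vcap Y' n := by
  induction n with
  | zero => rfl
  | succ n ih =>
    have h' : ∀ j ≤ n, Y j = Y' j := fun j hj => h j (by omega)
    rw [vcap, vcap, ih h', h (n + 1) le_rfl, h n (by omega), rmax_congr h']

lemma gstake_congr {Z Z' : ℕ → ℤ} {n : ℕ} (h : ∀ j ≤ n, Z j = Z' j) :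
    gstake Z n = gstake Z' n := by
  unfold gstake
  rw [h n le_rfl]
  congr 1
  apply Finset.sum_congr rfl
  intro i hi
  rw [Finset.mem_range] at hi
  have : ∀ j ≤ n - i, shft Z i j = shft Z' i j := by
    intro j hj
    simp only [shft]; rw [h (i + j) (by omega), h i (by omega)]
  unfold vstake
  rw [vcap_congr this, rmax_congr this]

lemma wcap_congr {R T : ℤ} {Z Z' : ℕ → ℤ} {n : ℕ} (h : ∀ j ≤ n, Z j = Z' j) :
    wcap R T Z n = wcap R T Z' n := by
  induction n with
  | zero => rfl
  | succ n ih =>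
    have h' : ∀ j ≤ n, Z j = Z' j := fun j hj => h j (by omega)
    rw [wcap, wcap, ih h', h (n + 1) le_rfl, h n (by omega), gstake_congr h']

lemma wstake_congr {R T : ℤ} {Z Z' : ℕ → ℤ} {n : ℕ} (h : ∀ j ≤ n, Z j = Z' j) :
    wstake R T Z n = wstake R T Z' n := by
  unfold wstake
  rw [wcap_congr h, gstake_congr h]

/-! ### Hitting times -/

/-- Times after `T` at which the path has moved by at least `η` since `T`. -/
def hitSet (η : ℝ) (ω : Omega) (T : ℝ≥0∞) : Set ℝ≥0 :=
  {r | T ≤ (r : ℝ≥0∞) ∧ η ≤ |ω.1 r - ω.1 T.toNNReal|}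

noncomputable def nxt (η : ℝ) (ω : Omega) (T : ℝ≥0∞) : ℝ≥0∞ :=
  ⨅ r ∈ hitSet η ω T, (r : ℝ≥0∞)

lemma hitSet_closed (η : ℝ) (ω : Omega) (T : ℝ≥0∞) : IsClosed (hitSet η ω T) := by
  apply IsClosed.inter
  · exact isClosed_le continuous_const ENNReal.continuous_coe
  · exact isClosed_le continuous_const ((ω.2.sub continuous_const).abs)

lemma nxt_mem {η : ℝ} {ω : Omega} {T : ℝ≥0∞} (h : nxt η ω T ≠ ⊤) :
    (nxt η ω T).toNNReal ∈ hitSet η ω T := by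
  have hne : (hitSet η ω T).Nonempty := by
    by_contra hcon
    rw [Set.not_nonempty_iff_eq_empty] at hcon
    apply h
    simp [nxt, hcon]
  have h1 : nxt η ω T = ((sInf (hitSet η ω T) : ℝ≥0) : ℝ≥0∞) := by
    rw [ENNReal.coe_sInf hne]; rfl
  rw [h1, ENNReal.toNNReal_coe]
  exact (hitSet_closed η ω T).csInf_mem hne (OrderBot.bddBelow _)

lemma nxt_le {η : ℝ} {ω : Omega} {T : ℝ≥0∞} {r : ℝ≥0} (hr : r ∈ hitSet η ω T) :
    nxt η ω T ≤ r := iInf₂_le r hr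

lemma nxt_le_iff (η : ℝ) (ω : Omega) (T : ℝ≥0∞) (t : ℝ≥0) :
    nxt η ω T ≤ t ↔ ∃ r ≤ t, r ∈ hitSet η ω T := by
  constructor
  · intro h
    have hne : nxt η ω T ≠ ⊤ := ne_top_of_le_ne_top ENNReal.coe_ne_top h
    refine ⟨_, ?_, nxt_mem hne⟩
    simpa using ENNReal.toNNReal_mono ENNReal.coe_ne_top h
  · rintro ⟨r, hr, hm⟩
    exact (nxt_le hm).trans (ENNReal.coe_le_coe.2 hr)

lemma le_nxt (η : ℝ) (ω : Omega) (T : ℝ≥0∞) : T ≤ nxt η ω T :=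
  le_iInf₂ fun _ hr => hr.1

/-- Successive times at which the path moves by `η`. -/
noncomputable def sig (η : ℝ) : ℕ → Omega → ℝ≥0∞
  | 0, _ => 0
  | n + 1, ω => nxt η ω (sig η n ω)

lemma sig_mono (η : ℝ) (ω : Omega) : Monotone (fun n => sig η n ω) :=
  monotone_nat_of_le_succ fun _ => le_nxt _ _ _

lemma abs_lt_of_lt_sig {η : ℝ} {ω : Omega} {n : ℕ} {r : ℝ≥0} (h1 : sig η n ω ≤ r)
    (h2 : (r : ℝ≥0∞) < sig η (n + 1) ω) :
    |ω.1 r - ω.1 (sig η n ω).toNNReal| < η := by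
  by_contra! h
  exact absurd (nxt_le (η := η) ⟨h1, h⟩) (not_le.2 h2)

/-- At a finite hitting time the path has moved by exactly `η`. -/
lemma sig_step {η : ℝ} (hη : 0 < η) {ω : Omega} {n : ℕ} (h : sig η (n + 1) ω ≠ ⊤) :
    |ω.1 (sig η (n + 1) ω).toNNReal - ω.1 (sig η n ω).toNNReal| = η := by
  have hm := nxt_mem (η := η) (ω := ω) (T := sig η n ω) h
  change (sig η (n + 1) ω).toNNReal ∈ _ at hm
  have hle : sig η n ω ≤ sig η (n + 1) ω := le_nxt _ _ _
  have hn : sig η n ω ≠ ⊤ := ne_top_of_le_ne_top h hle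
  set b := (sig η (n + 1) ω).toNNReal with hb
  set a := (sig η n ω).toNNReal with ha
  have hbe : sig η (n + 1) ω = b := (ENNReal.coe_toNNReal h).symm
  have hae : sig η n ω = a := (ENNReal.coe_toNNReal hn).symm
  have hab : a ≤ b := by rw [hbe, hae] at hle; exact_mod_cast hle
  refine le_antisymm ?_ hm.2
  by_contra! hgt
  have hcont : ContinuousOn (fun r : ℝ≥0 => |ω.1 r - ω.1 a|) (Set.Icc a b) :=
    ((ω.2.sub continuous_const).abs).continuousOn
  have hiv := intermediate_value_Icc hab hcont
  have : η ∈ Set.Icc |ω.1 a - ω.1 a| |ω.1 b - ω.1 a| := by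
    constructor
    · simpa using hη.le
    · exact hgt.le
  obtain ⟨r, hr, hre⟩ := hiv this
  have hrb : r < b := by
    rcases hr.2.lt_or_eq with h | h
    · exact h
    · rw [h] at hre; exact absurd hre hgt.ne'
  have := abs_lt_of_lt_sig (η := η) (ω := ω) (n := n) (r := r)
    (by rw [hae]; exact_mod_cast hr.1) (by rw [hbe]; exact_mod_cast hrb)
  exact absurd hre this.ne

lemma sig_tendsto {η : ℝ} (hη : 0 < η) (ω : Omega) :
    Tendsto (fun n => sig η n ω) atTop (𝓝 ⊤) := by
  have h := tendsto_atTop_iSup (sig_mono η ω)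
  by_cases htop : ⨆ n, sig η n ω = ⊤
  · rwa [htop] at h
  exfalso
  have hfin : ∀ n, sig η n ω ≠ ⊤ := fun n =>
    ne_top_of_le_ne_top htop (le_iSup (fun n => sig η n ω) n)
  have h1 : Tendsto (fun n => (sig η n ω).toNNReal) atTop (𝓝 (⨆ n, sig η n ω).toNNReal) :=
    (ENNReal.tendsto_toNNReal htop).comp h
  have h2 := (ω.2.tendsto _).comp h1
  have h3 := (((tendsto_add_atTop_iff_nat 1).2 h2).sub h2).abs
  have h4 : Tendsto (fun _ : ℕ => η) atTop (𝓝 η) := tendsto_const_nhds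
  have h5 := tendsto_nhds_unique h4 (h3.congr fun n => by
    simpa using sig_step hη (hfin (n + 1)))
  simp at h5
  exact hη.ne' h5

lemma exists_index {η : ℝ} (hη : 0 < η) (ω : Omega) (t : ℝ≥0) :
    ∃ n, sig η n ω ≤ t ∧ (t : ℝ≥0∞) < sig η (n + 1) ω := by
  classical
  have h : ∃ n, (t : ℝ≥0∞) < sig η n ω :=
    ((sig_tendsto hη ω).eventually (lt_mem_nhds ENNReal.coe_lt_top)).exists
  obtain ⟨n, hn⟩ : ∃ n, Nat.find h = n + 1 := by
    refine Nat.exists_eq_succ_of_ne_zero ?_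
    intro h0
    have := Nat.find_spec h
    rw [h0] at this
    simp [sig] at this
  refine ⟨n, ?_, ?_⟩
  · have := Nat.find_min h (m := n) (by omega)
    exact not_lt.1 this
  · have := Nat.find_spec h
    rwa [hn] at this

/-! ### Measurability -/

lemma F_mono {s t : ℝ≥0} (h : s ≤ t) : F s ≤ F t := by
  apply iSup_le
  rintro ⟨r, hr⟩
  exact le_iSup (fun s : {s : ℝ≥0 // s ≤ t} =>
    MeasurableSpace.comap (fun ω : Omega => ω.1 s.1) inferInstance) ⟨r, hr.trans h⟩

lemma eval_meas {s t : ℝ≥0} (h : s ≤ t) : Measurable[F t] (fun ω : Omega => ω.1 s) := by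
  rw [measurable_iff_comap_le]
  exact le_iSup (fun s : {s : ℝ≥0 // s ≤ t} =>
    MeasurableSpace.comap (fun ω : Omega => ω.1 s.1) inferInstance) ⟨s, h⟩

/-- The filtration as a Mathlib object. -/
def filt : @Filtration Omega ℝ≥0 _ ⊤ :=
  @Filtration.mk Omega ℝ≥0 _ ⊤ F (fun _ _ h => F_mono h) (fun _ => le_top)

lemma clip_meas {τ : Omega → ℝ≥0∞} (hτ : IsStopping τ) (t : ℝ≥0) :
    Measurable[F t] (fun ω : Omega => ω.1 (clip τ t ω)) := by
  let _ : MeasurableSpace Omega := ⊤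
  have had : StronglyAdapted filt (fun (s : ℝ≥0) (ω : Omega) => ω.1 s) := fun s =>
    (eval_meas (le_refl s)).stronglyMeasurable
  have hpr := had.isStronglyProgressive_of_continuous (fun ω => ω.2)
  have hst : IsStoppingTime filt (τ : Omega → WithTop ℝ≥0) := hτ
  have hst2 := hst.min_const t
  have := stronglyMeasurable_stoppedValue_of_le (n := t) hpr hst2 (fun _ => min_le_right _ _)
  have h2 : Measurable[F t] (stoppedValue (fun (s : ℝ≥0) (ω : Omega) => ω.1 s)
    (fun ω => min (τ ω : WithTop ℝ≥0) (t : WithTop ℝ≥0))) := this.measurable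
  convert h2 using 2 with ω
  unfold stoppedValue clip
  have hfin : min (τ ω) (t : ℝ≥0∞) ≠ ⊤ := ne_top_of_le_ne_top ENNReal.coe_ne_top (min_le_right _ _)
  have key : ∀ x : ℝ≥0∞, x ≠ ⊤ → x.toNNReal = WithTop.untopA (x : WithTop ℝ≥0) := by
    intro x hx
    lift x to ℝ≥0 using hx
    rfl
  exact congrArg ω.1 (key _ hfin)

lemma clip_of_le {τ : Omega → ℝ≥0∞} {t : ℝ≥0} {ω : Omega} (h : τ ω ≤ t) :
    clip τ t ω = (τ ω).toNNReal := by
  unfold clip; rw [min_eq_left h]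

lemma clip_of_ge {τ : Omega → ℝ≥0∞} {t : ℝ≥0} {ω : Omega} (h : (t : ℝ≥0∞) ≤ τ ω) :
    clip τ t ω = t := by
  unfold clip; rw [min_eq_right h, ENNReal.toNNReal_coe]

lemma sig_stopping {η : ℝ} (hη : 0 < η) (n : ℕ) : IsStopping (sig η n) := by
  induction n with
  | zero => intro t; simp [sig]
  | succ n ih =>
    intro t
    have hset : {ω : Omega | sig η (n + 1) ω ≤ t} =
        ⋂ m : ℕ, ⋃ i : ℕ, ({ω : Omega | sig η n ω ≤ ((min (TopologicalSpace.denseSeq ℝ≥0 i) t : ℝ≥0) : ℝ≥0∞)} ∩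
          {ω : Omega | η - 1 / ((m : ℝ) + 1) <
            |ω.1 (min (TopologicalSpace.denseSeq ℝ≥0 i) t) - ω.1 (clip (sig η n) t ω)|}) := by
      ext ω
      simp only [Set.mem_ofPred_eq, Set.mem_iInter, Set.mem_iUnion, Set.mem_inter_iff]
      constructor
      · intro h m
        obtain ⟨r, hrt, hr1, hr2⟩ := (nxt_le_iff η ω (sig η n ω) t).1 h
        have hnt : sig η n ω ≤ t := hr1.trans (ENNReal.coe_le_coe.2 hrt)
        rw [clip_of_le hnt]
        set a := (sig η n ω).toNNReal with ha
        have hae : sig η n ω = a :=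
          (ENNReal.coe_toNNReal (ne_top_of_le_ne_top ENNReal.coe_ne_top hnt)).symm
        rw [hae] at hr1 ⊢
        have har : a < r := by
          rcases (ENNReal.coe_le_coe.1 hr1).lt_or_eq with h | h
          · exact h
          · rw [h] at hr2; simp at hr2; linarith
        have hopen : IsOpen ({x : ℝ≥0 | a < x} ∩ {x : ℝ≥0 | η - 1 / ((m : ℝ) + 1) <
            |ω.1 (min x t) - ω.1 a|}) := by
          apply IsOpen.inter
          · exact isOpen_lt continuous_const continuous_id
          · exact isOpen_lt continuous_const
              (((ω.2.comp (continuous_id.min continuous_const)).sub continuous_const).abs)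
        have hpos : (0 : ℝ) < 1 / ((m : ℝ) + 1) := by positivity
        have hne : ({x : ℝ≥0 | a < x} ∩ {x : ℝ≥0 | η - 1 / ((m : ℝ) + 1) <
            |ω.1 (min x t) - ω.1 a|}).Nonempty := by
          refine ⟨r, har, ?_⟩
          simp only [Set.mem_ofPred_eq]
          rw [min_eq_left hrt]; linarith
        obtain ⟨x, hx, i, rfl⟩ :=
          (TopologicalSpace.denseRange_denseSeq ℝ≥0).inter_open_nonempty _ hopen hne
        refine ⟨i, ?_, hx.2⟩
        rw [ENNReal.coe_le_coe]
        exact le_min (le_of_lt hx.1) (har.le.trans hrt)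
      · intro h
        have hnt : sig η n ω ≤ t := by
          obtain ⟨i, hi, -⟩ := h 0
          exact hi.trans (ENNReal.coe_le_coe.2 (min_le_right _ _))
        rw [clip_of_le hnt] at h
        set a := (sig η n ω).toNNReal with ha
        have hae : sig η n ω = a :=
          (ENNReal.coe_toNNReal (ne_top_of_le_ne_top ENNReal.coe_ne_top hnt)).symm
        have hat : a ≤ t := by rw [hae] at hnt; exact_mod_cast hnt
        obtain ⟨r, hr, hmax⟩ := (isCompact_Icc (a := a) (b := t)).exists_isMaxOn
          ⟨a, le_rfl, hat⟩ (f := fun x => |ω.1 x - ω.1 a|)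
          ((ω.2.sub continuous_const).abs).continuousOn
        refine (nxt_le_iff η ω (sig η n ω) t).2 ⟨r, hr.2, ?_, ?_⟩
        · rw [hae]; exact_mod_cast hr.1
        · change η ≤ |ω.1 r - ω.1 a|
          refine le_of_forall_pos_lt_add fun ε hε => ?_
          obtain ⟨m, hm⟩ := exists_nat_one_div_lt hε
          obtain ⟨i, hi1, hi2⟩ := h m
          rw [hae, ENNReal.coe_le_coe] at hi1
          have h3 : |ω.1 (min (TopologicalSpace.denseSeq ℝ≥0 i) t) - ω.1 a| ≤ |ω.1 r - ω.1 a| :=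
            hmax ⟨hi1, min_le_right _ _⟩
          linarith
    rw [hset]
    refine MeasurableSet.iInter fun m => MeasurableSet.iUnion fun i => MeasurableSet.inter ?_ ?_
    · exact F_mono (min_le_right _ _) _ (ih _)
    · have h1 : Measurable[F t] (fun ω : Omega => ω.1 (min (TopologicalSpace.denseSeq ℝ≥0 i) t)) :=
        eval_meas (min_le_right _ _)
      have h2 := clip_meas ih t
      let _ : MeasurableSpace Omega := F t
      have h3 : Measurable (fun ω : Omega => |ω.1 (min (TopologicalSpace.denseSeq ℝ≥0 i) t)
        - ω.1 (clip (sig η n) t ω)|) := continuous_abs.measurable.comp (h1.sub h2)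
      exact measurableSet_lt measurable_const h3

/-- The integer-valued walk attached to a path. -/
noncomputable def walk (s k : ℝ) (ω : Omega) (n : ℕ) : ℤ :=
  round (s * k * (ω.1 (sig (1 / k) n ω).toNNReal - ω.1 0))

lemma stake_meas (s k a : ℝ) (hk : 0 < k) (R T : ℤ) (n : ℕ) :
    MeasurableAtTime (sig (1 / k) n) (fun ω => a * (wstake R T (walk s k ω) n : ℝ)) := by
  intro B hB t
  let Zt : Omega → (Fin (n + 1) → ℤ) := fun ω j =>
    round (s * k * (ω.1 (clip (sig (1 / k) j) t ω) - ω.1 0))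
  let ext : (Fin (n + 1) → ℤ) → ℕ → ℤ := fun z j => if h : j < n + 1 then z ⟨j, h⟩ else 0
  let H : (Fin (n + 1) → ℤ) → ℝ := fun z => a * (wstake R T (ext z) n : ℝ)
  have hst : ∀ j, IsStopping (sig (1 / k) j) := sig_stopping (by positivity)
  have hset : (fun ω => a * (wstake R T (walk s k ω) n : ℝ)) ⁻¹' B ∩
      {ω : Omega | sig (1 / k) n ω ≤ t} =
      (fun ω => H (Zt ω)) ⁻¹' B ∩ {ω : Omega | sig (1 / k) n ω ≤ t} := by
    ext ω
    simp only [Set.mem_inter_iff, Set.mem_preimage, Set.mem_ofPred_eq]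
    refine and_congr_left fun h => ?_
    have : wstake R T (walk s k ω) n = wstake R T (ext (Zt ω)) n := by
      apply wstake_congr
      intro j hj
      simp only [ext, Zt, walk]
      rw [dif_pos (by omega), clip_of_le ((sig_mono _ ω hj).trans h)]
    simp only [H]
    rw [this]
  rw [hset]
  refine MeasurableSet.inter ?_ (hst n t)
  have hZ : Measurable[F t] Zt := by
    let _ : MeasurableSpace Omega := F t
    refine measurable_pi_lambda _ fun j => ?_
    have h1 : Measurable (fun ω : Omega => ω.1 (clip (sig (1 / k) j) t ω)) := clip_meas (hst j) t
    have h2 : Measurable (fun ω : Omega => ω.1 0) := eval_meas zero_le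
    have h3 : Measurable (fun ω : Omega =>
      s * k * (ω.1 (clip (sig (1 / k) j) t ω) - ω.1 0)) := (h1.sub h2).const_mul _
    have h4 : Measurable (round : ℝ → ℤ) := by
      have : (round : ℝ → ℤ) = fun x => ⌊x + 1 / 2⌋ := by ext x; exact round_eq x
      rw [this]
      exact Int.measurable_floor.comp (measurable_id.add_const _)
    exact h4.comp h3
  have hH : Measurable H := Measurable.of_discrete
  let _ : MeasurableSpace Omega := F t
  exact (hH.comp hZ) hB

/-! ### The strategy -/

lemma walk_exact {s k : ℝ} (hs : s = 1 ∨ s = -1) (hk : 0 < k) (ω : Omega) (n : ℕ)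
    (h : sig (1 / k) n ω ≠ ⊤) :
    (walk s k ω n : ℝ) = s * k * (ω.1 (sig (1 / k) n ω).toNNReal - ω.1 0) := by
  suffices H : ∃ z : ℤ, (z : ℝ) = s * k * (ω.1 (sig (1 / k) n ω).toNNReal - ω.1 0) by
    obtain ⟨z, hz⟩ := H
    rw [walk, ← hz, round_intCast]
  induction n with
  | zero => exact ⟨0, by simp [sig]⟩
  | succ n ih =>
    obtain ⟨z, hz⟩ := ih (ne_top_of_le_ne_top h (le_nxt _ _ _))
    have hst := sig_step (by positivity : 0 < 1 / k) h
    have hk1 : k * (1 / k) = 1 := by field_simp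
    generalize ω.1 (sig (1 / k) (n + 1) ω).toNNReal = b at hst ⊢
    generalize ω.1 (sig (1 / k) n ω).toNNReal = a at hst hz
    generalize 1 / k = e at hst hk1
    rcases eq_or_eq_neg_of_abs_eq hst with h1 | h1 <;> rcases hs with h2 | h2
    · exact ⟨z + 1, by push_cast; rw [hz, ← hk1, ← h1, h2]; ring⟩
    · exact ⟨z - 1, by push_cast; rw [hz, ← hk1, ← h1, h2]; ring⟩
    · exact ⟨z - 1, by push_cast; rw [hz, ← hk1, ← neg_neg e, ← h1, h2]; ring⟩
    · exact ⟨z + 1, by push_cast; rw [hz, ← hk1, ← neg_neg e, ← h1, h2]; ring⟩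

lemma walk_step {s k : ℝ} (hs : s = 1 ∨ s = -1) (hk : 0 < k) (ω : Omega) (n : ℕ)
    (h : sig (1 / k) (n + 1) ω ≠ ⊤) :
    walk s k ω (n + 1) - walk s k ω n = 1 ∨ walk s k ω (n + 1) - walk s k ω n = -1 := by
  have h1 := walk_exact hs hk ω (n + 1) h
  have h0 := walk_exact hs hk ω n (ne_top_of_le_ne_top h (le_nxt _ _ _))
  have hst := sig_step (by positivity : 0 < 1 / k) h
  have habs : |((walk s k ω (n + 1) - walk s k ω n : ℤ) : ℝ)| = 1 := by
    push_cast
    rw [h1, h0, ← mul_sub, abs_mul, abs_mul, abs_of_pos hk]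
    have : |s| = 1 := by rcases hs with h | h <;> simp [h]
    rw [this]
    rw [show ω.1 (sig (1 / k) (n + 1) ω).toNNReal - ω.1 0 -
      (ω.1 (sig (1 / k) n ω).toNNReal - ω.1 0) = ω.1 (sig (1 / k) (n + 1) ω).toNNReal
        - ω.1 (sig (1 / k) n ω).toNNReal by ring, hst]
    field_simp
  have habsZ : |walk s k ω (n + 1) - walk s k ω n| = 1 := by exact_mod_cast habs
  exact eq_or_eq_neg_of_abs_eq habsZ

/-- The elementary strategy. -/
noncomputable def strat (s k : ℝ) (hk : 0 < k) (R T : ℤ) (hT : 0 < T) : ElemStrategy where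
  τ := sig (1 / k)
  stopping := sig_stopping (by positivity)
  mono := fun _ _ => le_nxt _ _ _
  tendsto_top := sig_tendsto (by positivity)
  h := fun n ω => (s * k / T) * (wstake R T (walk s k ω) n : ℝ)
  h_bdd := fun n => ⟨|s * k / T| * T, fun ω => by
    rw [abs_mul]
    refine mul_le_mul_of_nonneg_left ?_ (abs_nonneg _)
    exact_mod_cast wstake_le R T (walk s k ω) n hT.le⟩
  h_meas := fun n => stake_meas s k _ hk R T n

lemma capital_eq {s k : ℝ} (hs : s = 1 ∨ s = -1) (hk : 0 < k) (R T : ℤ) (hT : 0 < T)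
    (ω : Omega) (t : ℝ≥0) (n : ℕ) (h1 : sig (1 / k) n ω ≤ t)
    (h2 : (t : ℝ≥0∞) < sig (1 / k) (n + 1) ω) :
    elemCapital (strat s k hk R T hT) (8000 * ((R : ℝ) ^ 2 + 1) / T) t ω =
      ((wcap R T (walk s k ω) n : ℝ) + (wstake R T (walk s k ω) n : ℝ) *
        (s * k * (ω.1 t - ω.1 (sig (1 / k) n ω).toNNReal))) / T := by
  have hT' : (T : ℝ) ≠ 0 := by exact_mod_cast hT.ne'
  unfold elemCapital
  rw [tsum_eq_sum (s := Finset.range (n + 1))]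
  swap
  · intro j hj
    rw [Finset.mem_range, not_lt] at hj
    have ha : (t : ℝ≥0∞) ≤ sig (1 / k) j ω := h2.le.trans (sig_mono _ ω hj)
    have hb : (t : ℝ≥0∞) ≤ sig (1 / k) (j + 1) ω := ha.trans (le_nxt _ _ _)
    have e1 : clip ((strat s k hk R T hT).τ j) t ω = t := clip_of_ge ha
    have e2 : clip ((strat s k hk R T hT).τ (j + 1)) t ω = t := clip_of_ge hb
    rw [e1, e2, sub_self, mul_zero]
  rw [Finset.sum_range_succ]
  have key : ∀ m ≤ n, 8000 * ((R : ℝ) ^ 2 + 1) / T + ∑ j ∈ Finset.range m,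
      (strat s k hk R T hT).h j ω * (ω.1 (clip ((strat s k hk R T hT).τ (j + 1)) t ω)
        - ω.1 (clip ((strat s k hk R T hT).τ j) t ω))
      = (wcap R T (walk s k ω) m : ℝ) / T := by
    intro m
    induction m with
    | zero => intro _; simp [wcap]
    | succ m ih =>
      intro hm
      have hb : sig (1 / k) (m + 1) ω ≤ t := (sig_mono _ ω hm).trans h1
      have ha : sig (1 / k) m ω ≤ t := (le_nxt _ _ _).trans hb
      have e1 : clip ((strat s k hk R T hT).τ m) t ω = (sig (1 / k) m ω).toNNReal := clip_of_le ha
      have e2 : clip ((strat s k hk R T hT).τ (m + 1)) t ω = (sig (1 / k) (m + 1) ω).toNNReal :=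
        clip_of_le hb
      rw [Finset.sum_range_succ, ← add_assoc, ih (by omega), e1, e2, wcap_succ]
      push_cast
      rw [walk_exact hs hk ω _ (ne_top_of_le_ne_top ENNReal.coe_ne_top hb),
        walk_exact hs hk ω _ (ne_top_of_le_ne_top ENNReal.coe_ne_top ha)]
      change _ + (s * k / T) * (wstake R T (walk s k ω) m : ℝ) * _ = _
      field_simp
      ring
  rw [← add_assoc, key n le_rfl]
  have e1 : clip ((strat s k hk R T hT).τ n) t ω = (sig (1 / k) n ω).toNNReal := clip_of_le h1
  have e2 : clip ((strat s k hk R T hT).τ (n + 1)) t ω = t := clip_of_ge h2.le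
  rw [e1, e2]
  change _ + (s * k / T) * (wstake R T (walk s k ω) n : ℝ) * _ = _
  field_simp

lemma capital_nonneg {s k : ℝ} (hs : s = 1 ∨ s = -1) (hk : 0 < k) (R T : ℤ) (hT : 0 < T)
    (t : ℝ≥0) (ω : Omega) :
    0 ≤ elemCapital (strat s k hk R T hT) (8000 * ((R : ℝ) ^ 2 + 1) / T) t ω := by
  have hη : 0 < 1 / k := by positivity
  obtain ⟨n, h1, h2⟩ := exists_index hη ω t
  rw [capital_eq hs hk R T hT ω t n h1 h2]
  have hT' : (0 : ℝ) < T := by exact_mod_cast hT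
  refine div_nonneg ?_ hT'.le
  have hw := (wcap_nonneg R T (walk s k ω) n (fun j hj => walk_step hs hk ω j
    (ne_top_of_le_ne_top ENNReal.coe_ne_top ((sig_mono _ ω (by omega : j + 1 ≤ n)).trans h1)))).2
  have hw' : |(wstake R T (walk s k ω) n : ℝ)| ≤ (wcap R T (walk s k ω) n : ℝ) := by
    exact_mod_cast hw
  have hu : |s * k * (ω.1 t - ω.1 (sig (1 / k) n ω).toNNReal)| ≤ 1 := by
    rw [abs_mul, abs_mul, abs_of_pos hk]
    have : |s| = 1 := by rcases hs with h | h <;> simp [h]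
    rw [this, one_mul]
    have := abs_lt_of_lt_sig h1 h2
    rw [lt_div_iff₀ hk] at this
    linarith
  have := abs_mul (wstake R T (walk s k ω) n : ℝ)
    (s * k * (ω.1 t - ω.1 (sig (1 / k) n ω).toNNReal))
  have h3 := neg_abs_le ((wstake R T (walk s k ω) n : ℝ) *
    (s * k * (ω.1 t - ω.1 (sig (1 / k) n ω).toNNReal)))
  have h4 := mul_le_of_le_one_right (abs_nonneg (wstake R T (walk s k ω) n : ℝ)) hu
  linarith

/-- The paths that the strategy with parameters `s`, `N` exploits. -/
def Good (s : ℝ) (N : ℕ) (ω : Omega) : Prop :=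
  ∃ t t' : ℝ≥0, t ≤ t' ∧
    (∀ r r' : ℝ≥0, t ≤ r → r ≤ r' → r' ≤ t' →
      13 / 14 * (s * (ω.1 r - ω.1 t)) ≤ s * (ω.1 r' - ω.1 t)) ∧
    1 ≤ N * (s * (ω.1 t' - ω.1 t)) ∧
    ∀ r ≤ t', |ω.1 r - ω.1 0| ≤ N

lemma good_reaches {s : ℝ} (hs : s = 1 ∨ s = -1) (N q : ℕ) (hN : 1 ≤ N) (hq : 10 ≤ q)
    (ω : Omega) (hω : Good s N ω) :
    ∃ (t' : ℝ≥0) (j : ℕ), sig (1 / (4 * N * q : ℝ)) j ω ≤ t' ∧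
      (q : ℤ) ^ 3 ≤ wcap (4 * N ^ 2 * q + 1) ((q : ℤ) ^ 3) (walk s (4 * N * q) ω) j := by
  obtain ⟨t, t', htt', hdr, hbig, hbd⟩ := hω
  have hN' : (1 : ℝ) ≤ N := by exact_mod_cast hN
  have hq' : (10 : ℝ) ≤ q := by exact_mod_cast hq
  set k : ℝ := 4 * N * q with hkdef
  have hk : 0 < k := by positivity
  have hη : 0 < 1 / k := by positivity
  have hsabs : |s| = 1 := by rcases hs with h | h <;> simp [h]
  obtain ⟨p, hp1, hp2⟩ := exists_index hη ω t
  obtain ⟨n, hn1, hn2⟩ := exists_index hη ω t'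
  let u : ℕ → ℝ := fun j => s * k * (ω.1 (sig (1 / k) j ω).toNNReal - ω.1 t)
  have hfin : ∀ j ≤ n, sig (1 / k) j ω ≤ t' := fun j hj => (sig_mono _ ω hj).trans hn1
  have hfin' : ∀ j ≤ n, sig (1 / k) j ω ≠ ⊤ := fun j hj =>
    ne_top_of_le_ne_top ENNReal.coe_ne_top (hfin j hj)
  have hZ : ∀ j ≤ n, (walk s k ω j : ℝ) = u j + s * k * (ω.1 t - ω.1 0) := by
    intro j hj
    rw [walk_exact hs hk ω j (hfin' j hj)]
    simp only [u]; ring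
  have hstep : ∀ j < n, walk s k ω (j + 1) - walk s k ω j = 1 ∨
      walk s k ω (j + 1) - walk s k ω j = -1 := fun j hj => walk_step hs hk ω j (hfin' _ hj)
  have hclose : ∀ (m : ℕ) (r : ℝ≥0), sig (1 / k) m ω ≤ r → (r : ℝ≥0∞) < sig (1 / k) (m + 1) ω →
      |s * k * (ω.1 r - ω.1 (sig (1 / k) m ω).toNNReal)| ≤ 1 := by
    intro m r ha hb
    rw [abs_mul, abs_mul, abs_of_pos hk, hsabs, one_mul]
    have := abs_lt_of_lt_sig ha hb
    rw [lt_div_iff₀ hk] at this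
    linarith
  have hup : u p ≤ 1 := by
    have := abs_le.1 (hclose p t hp1 hp2)
    simp only [u]; linarith
  have hut' : 4 * (q : ℝ) ≤ s * k * (ω.1 t' - ω.1 t) := by
    have := mul_le_mul_of_nonneg_left hbig (by positivity : (0 : ℝ) ≤ 4 * q)
    rw [hkdef]; linarith
  have hun : 4 * (q : ℝ) - 1 ≤ u n := by
    have := abs_le.1 (hclose n t' hn1 hn2)
    simp only [u]; linarith
  have hpn : p ≤ n := by
    by_contra! h
    have : (t' : ℝ≥0∞) < t := hn2.trans_le ((sig_mono _ ω h).trans hp1)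
    exact absurd htt' (not_le.2 (by exact_mod_cast this))
  classical
  have hex : ∃ i, p ≤ i ∧ 20 ≤ u i := ⟨n, hpn, by linarith⟩
  obtain ⟨hpi, hui⟩ := Nat.find_spec hex
  have hin : Nat.find hex ≤ n := Nat.find_min' hex ⟨hpn, by linarith⟩
  have hmin := fun m (h : m < Nat.find hex) => Nat.find_min hex h
  generalize Nat.find hex = i at hpi hui hin hmin
  have hpi' : p < i := by
    rcases hpi.lt_or_eq with h | h
    · exact h
    · rw [← h] at hui; linarith
  have hui2 : u i < 21 := by
    obtain ⟨i', rfl⟩ : ∃ i', i = i' + 1 := ⟨i - 1, by omega⟩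
    have h1 : u i' < 20 := by
      have := hmin i' (by omega)
      by_contra! h
      exact this ⟨by omega, h⟩
    have h2 := hZ i' (by omega)
    have h3 := hZ (i' + 1) (by omega)
    have h4 : (walk s k ω (i' + 1) : ℝ) - walk s k ω i' ≤ 1 := by
      have : walk s k ω (i' + 1) - walk s k ω i' ≤ 1 := by
        rcases hstep i' (by omega) with h | h <;> omega
      exact_mod_cast this
    linarith
  have hdrop : ∀ j l, i ≤ j → j ≤ l → l ≤ n → 13 / 14 * u j ≤ u l := by
    intro j l hij hjl hln
    have h1 : t ≤ (sig (1 / k) j ω).toNNReal := by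
      have : (t : ℝ≥0∞) ≤ sig (1 / k) j ω := hp2.le.trans (sig_mono _ ω (by omega))
      simpa using ENNReal.toNNReal_mono (hfin' j (by omega)) this
    have h2 : (sig (1 / k) j ω).toNNReal ≤ (sig (1 / k) l ω).toNNReal :=
      ENNReal.toNNReal_mono (hfin' l hln) (sig_mono _ ω hjl)
    have h3 : (sig (1 / k) l ω).toNNReal ≤ t' := by
      simpa using ENNReal.toNNReal_mono ENNReal.coe_ne_top (hfin l hln)
    have h4 := mul_le_mul_of_nonneg_left (hdr _ _ h1 h2 h3) hk.le
    simp only [u]; linarith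
  have h0 : walk s k ω 0 = 0 := by simp [walk, sig]
  suffices H : ∃ j ≤ n, (q : ℤ) ^ 3 ≤ wcap (4 * N ^ 2 * q + 1) ((q : ℤ) ^ 3) (walk s k ω) j by
    obtain ⟨j, hj, hj2⟩ := H
    exact ⟨t', j, hfin j hj, hj2⟩
  refine wcap_reaches (4 * N ^ 2 * q + 1) ((q : ℤ) ^ 3) (walk s k ω) i n hin h0
    hstep ?_ ?_ ?_
  · intro j hj
    have h1 := walk_exact hs hk ω j (hfin' j hj)
    have h2 := hbd (sig (1 / k) j ω).toNNReal (by
      simpa using ENNReal.toNNReal_mono ENNReal.coe_ne_top (hfin j hj))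
    have h3 : |(walk s k ω j : ℝ)| < 4 * N ^ 2 * q + 1 := by
      rw [h1, abs_mul, abs_mul, abs_of_pos hk, hsabs, one_mul]
      have := mul_le_mul_of_nonneg_left h2 hk.le
      rw [hkdef] at this ⊢
      linarith
    exact_mod_cast h3
  · intro j l hij hjl hln
    have h1 := hdrop j l hij hjl hln
    have h2 := hdrop i j le_rfl hij (by omega)
    have e1 := hZ j (by omega)
    have e2 := hZ l hln
    have e3 := hZ i hin
    have : 7 * ((walk s k ω j : ℝ) - walk s k ω l + 1) ≤ walk s k ω j - walk s k ω i + 20 := by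
      rw [e1, e2, e3]; linarith
    exact_mod_cast this
  · have e1 := hZ n le_rfl
    have e3 := hZ i hin
    have h5 : (2 * q : ℝ) ≤ (walk s k ω n : ℝ) - walk s k ω i + 20 := by
      rw [e1, e3]; linarith
    have h6 : (2 * q : ℤ) ≤ walk s k ω n - walk s k ω i + 20 := by exact_mod_cast h5
    have h7 := pow_le_pow_left₀ (by positivity : (0 : ℤ) ≤ 2 * q) h6 3
    have h8 : (0 : ℤ) ≤ (q : ℤ) ^ 3 := by positivity
    refine le_trans ?_ h7
    rw [mul_pow]; linarith

/-- For every `ε > 0` a strategy with initial capital at most `ε` ends up with capital at least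
`1` on the good set. -/
lemma exists_strat {s : ℝ} (hs : s = 1 ∨ s = -1) (N : ℕ) (hN : 1 ≤ N) (ε : ℝ) (hε : 0 < ε) :
    ∃ (G : ElemStrategy) (c : ℝ), 0 < c ∧ c ≤ ε ∧ (∀ t ω, 0 ≤ elemCapital G c t ω) ∧
      ∀ ω, Good s N ω → ∀ᶠ t in atTop, 1 ≤ elemCapital G c t ω := by
  obtain ⟨q₀, hq₀⟩ := exists_nat_ge (8000 * 26 * (N : ℝ) ^ 4 / ε)
  set q := max q₀ 10 with hqdef
  have hq : 10 ≤ q := le_max_right _ _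
  have hqq : 8000 * 26 * (N : ℝ) ^ 4 / ε ≤ q := hq₀.trans (by exact_mod_cast le_max_left _ _)
  have hN' : (1 : ℝ) ≤ N := by exact_mod_cast hN
  have hq' : (10 : ℝ) ≤ q := by exact_mod_cast hq
  have hk : (0 : ℝ) < 4 * N * q := by positivity
  have hT : (0 : ℤ) < (q : ℤ) ^ 3 := by positivity
  have hT' : (0 : ℝ) < (((q : ℤ) ^ 3 : ℤ) : ℝ) := by exact_mod_cast hT
  refine ⟨strat s (4 * N * q) hk (4 * N ^ 2 * q + 1) ((q : ℤ) ^ 3) hT,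
    8000 * (((4 * N ^ 2 * q + 1 : ℤ) : ℝ) ^ 2 + 1) / ((q : ℤ) ^ 3 : ℤ), by positivity, ?_,
    fun t ω => capital_nonneg hs hk _ _ hT t ω, ?_⟩
  · rw [div_le_iff₀ hT']
    rw [div_le_iff₀ hε] at hqq
    push_cast
    have h1 : (1 : ℝ) ≤ (N : ℝ) ^ 2 * q := by
      have : (1 : ℝ) ≤ (N : ℝ) ^ 2 := one_le_pow₀ hN'
      nlinarith
    have h2 : (4 * (N : ℝ) ^ 2 * q + 1) ^ 2 + 1 ≤ 26 * ((N : ℝ) ^ 2 * q) ^ 2 := by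
      nlinarith
    have h3 := mul_le_mul_of_nonneg_right hqq (by positivity : (0 : ℝ) ≤ (q : ℝ) ^ 2)
    calc 8000 * ((4 * (N : ℝ) ^ 2 * q + 1) ^ 2 + 1) ≤ 8000 * (26 * ((N : ℝ) ^ 2 * q) ^ 2) := by
          linarith
      _ = 8000 * 26 * (N : ℝ) ^ 4 * (q : ℝ) ^ 2 := by ring
      _ ≤ q * ε * (q : ℝ) ^ 2 := h3
      _ = ε * (q : ℝ) ^ 3 := by ring
  · intro ω hω
    obtain ⟨t', j, hj, hw⟩ := good_reaches hs N q hN hq ω hω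
    filter_upwards [eventually_ge_atTop t'] with t ht
    obtain ⟨n, hn1, hn2⟩ := exists_index (by positivity : (0 : ℝ) < 1 / (4 * N * q)) ω t
    have hjn : j ≤ n := by
      by_contra! h
      have : sig (1 / (4 * N * q : ℝ)) (n + 1) ω ≤ t :=
        ((sig_mono _ ω h).trans hj).trans (by exact_mod_cast ht)
      exact absurd hn2 (not_lt.2 this)
    obtain ⟨d, rfl⟩ := Nat.exists_eq_add_of_le hjn
    have hw2 := wcap_stable _ _ _ j d hw
    rw [capital_eq hs hk _ _ hT ω t _ hn1 hn2, wstake_eq_zero _ _ _ _ hw2, le_div_iff₀ hT']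
    have : (((q : ℤ) ^ 3 : ℤ) : ℝ) ≤ (wcap (4 * N ^ 2 * q + 1) ((q : ℤ) ^ 3)
      (walk s (4 * N * q) ω) (j + d) : ℝ) := by exact_mod_cast hw2
    simpa using this

lemma good_of_deriv (ω : Omega) (t : ℝ≥0) (L : ℝ) (hL : L ≠ 0) (h : HasDerivAtTime ω t L) :
    ∃ s : ℝ, (s = 1 ∨ s = -1) ∧ ∃ N₀ : ℕ, ∀ N ≥ N₀, Good s N ω := by
  obtain ⟨s, hs, hsL⟩ : ∃ s : ℝ, (s = 1 ∨ s = -1) ∧ 0 < s * L := by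
    rcases lt_or_gt_of_ne hL with h | h
    · exact ⟨-1, Or.inr rfl, by linarith⟩
    · exact ⟨1, Or.inl rfl, by linarith⟩
  refine ⟨s, hs, ?_⟩
  set A := s * L with hA
  have h1 : Tendsto (fun r : ℝ≥0 => s * ((ω.1 r - ω.1 t) / ((r : ℝ) - (t : ℝ)))) (𝓝[≠] t) (𝓝 A) :=
    h.const_mul s
  have h2 : ∀ᶠ r in 𝓝[≠] t, s * ((ω.1 r - ω.1 t) / ((r : ℝ) - (t : ℝ))) ∈
      Set.Ioo (26 / 27 * A) (28 / 27 * A) :=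
    h1.eventually (Ioo_mem_nhds (by linarith) (by linarith))
  rw [eventually_nhdsWithin_iff, Metric.eventually_nhds_iff] at h2
  obtain ⟨δ, hδ, h3⟩ := h2
  let d : ℝ≥0 := ⟨δ / 2, by positivity⟩
  have hd : (d : ℝ) = δ / 2 := rfl
  have hd0 : 0 < d := by rw [← NNReal.coe_pos, hd]; positivity
  have hbnd : ∀ r : ℝ≥0, t ≤ r → r ≤ t + d →
      26 / 27 * A * ((r : ℝ) - t) ≤ s * (ω.1 r - ω.1 t) ∧
      s * (ω.1 r - ω.1 t) ≤ 28 / 27 * A * ((r : ℝ) - t) := by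
    intro r hr1 hr2
    rcases hr1.lt_or_eq with hlt | heq
    · have hlt' : (0 : ℝ) < (r : ℝ) - t := sub_pos.2 (by exact_mod_cast hlt)
      have hr2' : (r : ℝ) ≤ t + d := by exact_mod_cast hr2
      have := h3 (y := r) (by
        rw [NNReal.dist_eq, abs_of_pos hlt']; linarith) hlt.ne'
      rw [← mul_div_assoc] at this
      have ha := (lt_div_iff₀ hlt').1 this.1
      have hb := (div_lt_iff₀ hlt').1 this.2
      exact ⟨ha.le, hb.le⟩
    · subst heq; simp
  have hpos : 0 < s * (ω.1 (t + d) - ω.1 t) := by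
    have := (hbnd (t + d) (le_add_of_nonneg_right hd0.le) le_rfl).1
    push_cast at this
    have h4 : 0 < 26 / 27 * A * ((t : ℝ) + d - t) := by
      have : (0 : ℝ) < d := hd0
      have e : (t : ℝ) + d - t = d := by ring
      rw [e]; positivity
    linarith
  obtain ⟨C, hC⟩ := (isCompact_Icc (a := (0 : ℝ≥0)) (b := t + d)).exists_bound_of_continuousOn
    (f := fun r => ω.1 r - ω.1 0) (ω.2.sub continuous_const).continuousOn
  obtain ⟨N₁, hN₁⟩ := exists_nat_ge C
  obtain ⟨N₂, hN₂⟩ := exists_nat_ge (1 / (s * (ω.1 (t + d) - ω.1 t)))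
  refine ⟨max N₁ N₂, fun N hN => ⟨t, t + d, le_add_of_nonneg_right hd0.le, ?_, ?_, ?_⟩⟩
  · intro r r' hr hrr' hr'
    have ha := (hbnd r hr (hrr'.trans hr')).2
    have hb := (hbnd r' (hr.trans hrr') hr').1
    have hc : A * ((r : ℝ) - t) ≤ A * ((r' : ℝ) - t) :=
      mul_le_mul_of_nonneg_left (sub_le_sub_right (by exact_mod_cast hrr') _) hsL.le
    linarith
  · have : (N₂ : ℝ) ≤ N := by exact_mod_cast (le_max_right _ _).trans hN
    have h5 := hN₂.trans this
    rwa [div_le_iff₀ hpos] at h5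
  · intro r hr
    have h6 : (N₁ : ℝ) ≤ N := by exact_mod_cast (le_max_left _ _).trans hN
    have := hC r ⟨zero_le, hr⟩
    rw [Real.norm_eq_abs] at this
    linarith

/-- The sign attached to an index. -/
noncomputable def sgn (n : ℕ) : ℝ := if Even n then 1 else -1

lemma sgn_or (n : ℕ) : sgn n = 1 ∨ sgn n = -1 := by
  unfold sgn; split_ifs <;> simp

/-- almost surely, `ω` does not have a non-zero derivative
anywhere: the set of `ω` admitting some `t` with a non-zero derivative is null. -/
theorem no_nonzero_derivative :
    IsNull {ω : Omega | ∃ t : ℝ≥0, ∃ L : ℝ, L ≠ 0 ∧ HasDerivAtTime ω t L} := by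
  unfold IsNull UpProb
  refine le_antisymm (ENNReal.le_of_forall_pos_le_add fun ε hε _ => ?_) zero_le
  have hε' : (0 : ℝ) < ε := hε
  have hex := fun n : ℕ => exists_strat (sgn_or n) (n + 1) (by omega)
    ((ε : ℝ) / 2 / 2 ^ n) (by positivity)
  choose G c hc0 hcε hnn hgood using hex
  have hsum : HasSum (fun n : ℕ => (ε : ℝ) / 2 / 2 ^ n) ε := hasSum_geometric_two' _
  have hsc : Summable c := Summable.of_nonneg_of_le (fun n => (hc0 n).le) hcε hsum.summable
  let S : PosCapital := ⟨G, c, hc0, hsc, hnn⟩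
  refine (iInf₂_le S ?_).trans ?_
  · intro ω
    by_cases hω : ω ∈ {ω : Omega | ∃ t : ℝ≥0, ∃ L : ℝ, L ≠ 0 ∧ HasDerivAtTime ω t L}
    · rw [Set.indicator_of_mem hω]
      obtain ⟨t, L, hL, hd⟩ := hω
      obtain ⟨s, hs, N₀, hN⟩ := good_of_deriv ω t L hL hd
      obtain ⟨n, hn, hsn⟩ : ∃ n, N₀ ≤ n + 1 ∧ sgn n = s := by
        rcases hs with h | h
        · exact ⟨2 * N₀, by omega, by simp [sgn, h]⟩
        · exact ⟨2 * N₀ + 1, by omega, by simp [sgn, h]⟩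
      have hg := hgood n ω (by rw [hsn]; exact hN _ hn)
      refine le_liminf_of_le (by isBoundedDefault) ?_
      filter_upwards [hg] with r hr
      refine le_trans ?_ (ENNReal.le_tsum n)
      change 1 ≤ ENNReal.ofReal (elemCapital (G n) (c n) r ω)
      rwa [ENNReal.one_le_ofReal]
    · rw [Set.indicator_of_notMem hω]; exact zero_le
  · rw [zero_add]
    change ∑' n, ENNReal.ofReal (c n) ≤ ε
    rw [← ENNReal.ofReal_tsum_of_nonneg (fun n => (hc0 n).le) hsc]
    rw [← ENNReal.ofReal_coe_nnreal]
    apply ENNReal.ofReal_le_ofReal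
    exact (hsc.tsum_le_tsum hcε hsum.summable).trans hsum.tsum_eq.le

end GTP
end

section
/- The event {ω ∈ Ω : ω is constant on [0,∞)} is completely uncertain, i.e. both this event and its complement have upper probability 1. -/
open Filter Topology MeasureTheory
open scoped ENNReal NNReal

namespace GTP

/-! ### Part A: from a continuous martingale with nonconstant paths to the upper probability -/

structure IsModel {S : Type} [MeasurableSpace S] (P : Measure S) (Φ : S → Omega) (Y : S → ℝ) :
    Prop where
  const : ∀ z, ∀ t : ℝ≥0, 1 ≤ t → (Φ z).1 t = (Φ z).1 1
  meas : @Measurable S Omega _ (F 1) Φ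
  int : Integrable Y P
  bound : ∀ z t, |(Φ z).1 t| ≤ Y z
  mart : ∀ m j : ℕ, j < 2 ^ m → ∀ g : Omega → ℝ, Measurable[F ((j : ℝ≥0) / 2 ^ m)] g →
    (∃ C, ∀ ω, |g ω| ≤ C) →
    ∫ z, g (Φ z) * ((Φ z).1 (((j + 1 : ℕ) : ℝ≥0) / 2 ^ m) - (Φ z).1 ((j : ℝ≥0) / 2 ^ m)) ∂P = 0
  nonconst : ∀ᵐ z ∂P, (Φ z).1 0 ≠ (Φ z).1 1

lemma clip_le (τ : Omega → ℝ≥0∞) (t : ℝ≥0) (ω : Omega) : clip τ t ω ≤ t := by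
  unfold clip
  exact ENNReal.toNNReal_mono ENNReal.coe_ne_top (min_le_right _ _)

lemma coe_clip (τ : Omega → ℝ≥0∞) (t : ℝ≥0) (ω : Omega) :
    ((clip τ t ω : ℝ≥0) : ℝ≥0∞) = min (τ ω) t := by
  unfold clip
  exact ENNReal.coe_toNNReal (ne_top_of_le_ne_top ENNReal.coe_ne_top (min_le_right _ _))

lemma ind_meas {τ : Omega → ℝ≥0∞} {h : Omega → ℝ} (hτ : IsStopping τ)
    (hh : MeasurableAtTime τ h) (t : ℝ≥0) :
    Measurable[F t] (({ω : Omega | τ ω ≤ (t : ℝ≥0∞)}).indicator h) := by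
  intro B hB
  rw [Set.indicator_preimage]
  rw [Set.ite]
  refine MeasurableSet.union (hh B hB t) ?_
  refine MeasurableSet.diff ?_ (hτ t)
  exact @measurable_const ℝ Omega _ (F t) 0 B hB

lemma tele (u : ℝ≥0) (hu : u ≤ 1) (f : ℝ≥0 → ℝ) (m : ℕ) (T : ℝ≥0∞)
    (hT : (u : ℝ≥0∞) = min T ((1 : ℝ≥0) : ℝ≥0∞)) (c : ℝ) :
    ∑ j ∈ Finset.range (2 ^ m),
      (if T ≤ (((j : ℝ≥0) / 2 ^ m : ℝ≥0) : ℝ≥0∞) then c else 0) *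
        (f (((j + 1 : ℕ) : ℝ≥0) / 2 ^ m) - f ((j : ℝ≥0) / 2 ^ m)) =
    c * (f 1 - f ((⌈u * 2 ^ m⌉₊ : ℝ≥0) / 2 ^ m)) := by
  have hpos : (0 : ℝ≥0) < 2 ^ m := by positivity
  have h1 : ∀ j ∈ Finset.range (2 ^ m), (if T ≤ (((j : ℝ≥0) / 2 ^ m : ℝ≥0) : ℝ≥0∞) then c else 0) *
        (f (((j + 1 : ℕ) : ℝ≥0) / 2 ^ m) - f ((j : ℝ≥0) / 2 ^ m)) =
      if ⌈u * 2 ^ m⌉₊ ≤ j then c * (f (((j + 1 : ℕ) : ℝ≥0) / 2 ^ m) - f ((j : ℝ≥0) / 2 ^ m))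
        else 0 := by
    intro j hj
    have hj' : (j : ℝ≥0) / 2 ^ m < 1 := by
      rw [div_lt_one hpos]
      exact_mod_cast Finset.mem_range.1 hj
    have : T ≤ (((j : ℝ≥0) / 2 ^ m : ℝ≥0) : ℝ≥0∞) ↔ ⌈u * 2 ^ m⌉₊ ≤ j := by
      rw [Nat.ceil_le, ← le_div_iff₀ hpos, ← ENNReal.coe_le_coe, hT, min_le_iff, or_iff_left]
      rw [ENNReal.coe_le_coe]
      exact not_le.2 hj'
    simp only [this]
    split_ifs <;> simp
  rw [Finset.sum_congr rfl h1, ← Finset.sum_filter]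
  have hJ : ⌈u * 2 ^ m⌉₊ ≤ 2 ^ m := by
    rw [Nat.ceil_le]
    push_cast
    exact mul_le_of_le_one_left hpos.le hu
  have h2 : (Finset.range (2 ^ m)).filter (fun j => ⌈u * 2 ^ m⌉₊ ≤ j) =
      Finset.Ico ⌈u * 2 ^ m⌉₊ (2 ^ m) := by
    ext j; simp [and_comm]
  rw [h2, ← Finset.mul_sum, Finset.sum_Ico_sub (fun j : ℕ => f ((j : ℝ≥0) / 2 ^ m)) hJ]
  congr 3
  push_cast
  exact div_self hpos.ne'

lemma ceil_tendsto (u : ℝ≥0) :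
    Tendsto (fun m : ℕ => ((⌈u * 2 ^ m⌉₊ : ℝ≥0) / 2 ^ m)) atTop (𝓝 u) := by
  have h := (tendsto_nat_ceil_mul_div_atTop (R := ℝ) (a := u) u.2).comp
    (tendsto_pow_atTop_atTop_of_one_lt (by norm_num : (1 : ℝ) < 2))
  rw [← NNReal.tendsto_coe]
  refine h.congr fun m => ?_
  have : ⌈(u : ℝ) * 2 ^ m⌉₊ = ⌈u * 2 ^ m⌉₊ := by
    refine eq_of_forall_ge_iff fun c => ?_
    rw [Nat.ceil_le, Nat.ceil_le, ← NNReal.coe_le_coe]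
    push_cast
    rfl
  simp [this]

section
variable {S : Type} [MeasurableSpace S] {P : Measure S} [IsProbabilityMeasure P] {Φ : S → Omega}
  {Y : S → ℝ}

set_option linter.unusedSectionVars false

lemma IsModel.eval_meas (M : IsModel P Φ Y) (t : ℝ≥0) : Measurable (fun z => (Φ z).1 t) := by
  have key : ∀ t : ℝ≥0, t ≤ 1 → Measurable (fun z => (Φ z).1 t) := fun t ht =>
    (GTP.eval_meas ht).comp M.meas
  rcases le_total t 1 with h | h
  · exact key t h
  · have : (fun z => (Φ z).1 t) = fun z => (Φ z).1 1 := funext fun z => M.const z t h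
    rw [this]; exact key 1 le_rfl

lemma IsModel.optional_sampling (M : IsModel P Φ Y) {τ : Omega → ℝ≥0∞} {h : Omega → ℝ} (hτ : IsStopping τ)
    (hh : MeasurableAtTime τ h) {C : ℝ} (hC : ∀ ω, |h ω| ≤ C) :
    Integrable (fun z => h (Φ z) * ((Φ z).1 1 - (Φ z).1 (clip τ 1 (Φ z)))) P ∧
      ∫ z, h (Φ z) * ((Φ z).1 1 - (Φ z).1 (clip τ 1 (Φ z))) ∂P = 0 := by
  set g : ℝ≥0 → Omega → ℝ := fun t => ({ω : Omega | τ ω ≤ (t : ℝ≥0∞)}).indicator h with hg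
  have hgC : ∀ t ω, |g t ω| ≤ C := by
    intro t ω
    simp only [hg, Set.indicator]
    split_ifs
    · exact hC ω
    · simpa using (abs_nonneg _).trans (hC ω)
  set fm : ℕ → S → ℝ := fun m z => ∑ j ∈ Finset.range (2 ^ m), g ((j : ℝ≥0) / 2 ^ m) (Φ z) *
    ((Φ z).1 (((j + 1 : ℕ) : ℝ≥0) / 2 ^ m) - (Φ z).1 ((j : ℝ≥0) / 2 ^ m)) with hfm
  have hgm : ∀ m j : ℕ, j < 2 ^ m → Measurable (fun z => g ((j : ℝ≥0) / 2 ^ m) (Φ z)) := by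
    intro m j hj
    refine ((ind_meas hτ hh _).mono (F_mono ?_) le_rfl).comp M.meas
    rw [div_le_one (by positivity)]
    exact_mod_cast hj.le
  have htermI : ∀ m j : ℕ, j < 2 ^ m → Integrable (fun z => g ((j : ℝ≥0) / 2 ^ m) (Φ z) *
    ((Φ z).1 (((j + 1 : ℕ) : ℝ≥0) / 2 ^ m) - (Φ z).1 ((j : ℝ≥0) / 2 ^ m))) P := by
    intro m j hj
    refine Integrable.mono' ((M.int.const_mul (C * 2))) ?_ ?_
    · exact ((hgm m j hj).mul ((M.eval_meas _).sub (M.eval_meas _))).aestronglyMeasurable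
    · refine Eventually.of_forall fun z => ?_
      rw [Real.norm_eq_abs, abs_mul, mul_assoc]
      have h1 := M.bound z (((j + 1 : ℕ) : ℝ≥0) / 2 ^ m)
      have h2 := M.bound z ((j : ℝ≥0) / 2 ^ m)
      refine mul_le_mul (hgC _ _) ?_ (abs_nonneg _) ((abs_nonneg _).trans (hC (Φ z)))
      refine (abs_sub _ _).trans ?_
      linarith
  have hfmI : ∀ m, Integrable (fm m) P := fun m =>
    integrable_finsetSum _ fun j hj => htermI m j (Finset.mem_range.1 hj)
  have hfm0 : ∀ m, ∫ z, fm m z ∂P = 0 := by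
    intro m
    rw [integral_finsetSum _ fun j hj => htermI m j (Finset.mem_range.1 hj)]
    refine Finset.sum_eq_zero fun j hj => ?_
    exact M.mart m j (Finset.mem_range.1 hj) _ (ind_meas hτ hh _) ⟨C, hgC _⟩
  have hfmE : ∀ m z, fm m z =
      h (Φ z) * ((Φ z).1 1 - (Φ z).1 ((⌈clip τ 1 (Φ z) * 2 ^ m⌉₊ : ℝ≥0) / 2 ^ m)) := by
    intro m z
    rw [← tele (clip τ 1 (Φ z)) (clip_le _ _ _) (Φ z).1 m (τ (Φ z)) (coe_clip _ _ _)]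
    simp only [hfm, hg, Set.indicator, Set.mem_ofPred_eq]
    congr!
  have hlim : ∀ z, Tendsto (fun m => fm m z) atTop
      (𝓝 (h (Φ z) * ((Φ z).1 1 - (Φ z).1 (clip τ 1 (Φ z))))) := by
    intro z
    simp only [hfmE]
    refine Tendsto.const_mul _ (Tendsto.const_sub _ ?_)
    exact ((Φ z).2.tendsto _).comp (ceil_tendsto _)
  have hbd : ∀ (z : S) (s : ℝ≥0), ‖h (Φ z) * ((Φ z).1 1 - (Φ z).1 s)‖ ≤ C * 2 * Y z := by
    intro z s
    rw [Real.norm_eq_abs, abs_mul, mul_assoc]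
    have h1 := M.bound z 1
    have h2 := M.bound z s
    refine mul_le_mul (hC _) ?_ (abs_nonneg _) ((abs_nonneg _).trans (hC (Φ z)))
    refine (abs_sub _ _).trans ?_
    linarith
  have hsm : AEStronglyMeasurable (fun z => h (Φ z) * ((Φ z).1 1 - (Φ z).1 (clip τ 1 (Φ z)))) P :=
    aestronglyMeasurable_of_tendsto_ae atTop (fun m => (hfmI m).aestronglyMeasurable)
      (Eventually.of_forall hlim)
  refine ⟨Integrable.mono' (M.int.const_mul (C * 2)) hsm
    (Eventually.of_forall fun z => hbd z _), ?_⟩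
  have := tendsto_integral_of_dominated_convergence (μ := P) (F := fm) (fun z => C * 2 * Y z)
    (fun m => (hfmI m).aestronglyMeasurable) (M.int.const_mul (C * 2))
    (fun m => Eventually.of_forall fun z => by rw [hfmE]; exact hbd z _)
    (Eventually.of_forall hlim)
  simp only [hfm0] at this
  exact tendsto_nhds_unique this tendsto_const_nhds |>.symm ▸ rfl

/-- one gain term -/
noncomputable def gain (G : ElemStrategy) (n : ℕ) (t : ℝ≥0) (ω : Omega) : ℝ :=
  G.h n ω * (ω.1 (clip (G.τ (n + 1)) t ω) - ω.1 (clip (G.τ n) t ω))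

lemma IsModel.gain_int (M : IsModel P Φ Y) (G : ElemStrategy) (n : ℕ) :
    Integrable (fun z => gain G n 1 (Φ z)) P ∧ ∫ z, gain G n 1 (Φ z) ∂P = 0 := by
  obtain ⟨C, hC⟩ := G.h_bdd n
  have h1 := M.optional_sampling (G.stopping n) (G.h_meas n) hC
  have hm : MeasurableAtTime (G.τ (n + 1)) (G.h n) := by
    intro B hB t
    have : G.h n ⁻¹' B ∩ {ω : Omega | G.τ (n + 1) ω ≤ (t : ℝ≥0∞)} =
        (G.h n ⁻¹' B ∩ {ω : Omega | G.τ n ω ≤ (t : ℝ≥0∞)}) ∩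
          {ω : Omega | G.τ (n + 1) ω ≤ (t : ℝ≥0∞)} := by
      ext ω
      simp only [Set.mem_inter_iff, Set.mem_ofPred_eq, Set.mem_preimage]
      exact ⟨fun h => ⟨⟨h.1, (G.mono n ω).trans h.2⟩, h.2⟩, fun h => ⟨h.1.1, h.2⟩⟩
    rw [this]
    exact (G.h_meas n B hB t).inter (G.stopping (n + 1) t)
  have h2 := M.optional_sampling (G.stopping (n + 1)) hm hC
  have e : (fun z => gain G n 1 (Φ z)) = fun z =>
      G.h n (Φ z) * ((Φ z).1 1 - (Φ z).1 (clip (G.τ n) 1 (Φ z))) -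
      G.h n (Φ z) * ((Φ z).1 1 - (Φ z).1 (clip (G.τ (n + 1)) 1 (Φ z))) := by
    funext z; unfold gain; ring
  rw [e]
  refine ⟨h1.1.sub h2.1, ?_⟩
  rw [integral_sub h1.1 h2.1, h1.2, h2.2, sub_zero]

lemma tau_mono (G : ElemStrategy) (ω : Omega) : Monotone (fun n => G.τ n ω) :=
  monotone_nat_of_le_succ fun n => G.mono n ω

lemma gain_eq_zero (G : ElemStrategy) {N n : ℕ} (h : N ≤ n) (ω : Omega) (t : ℝ≥0)
    (hN : (t : ℝ≥0∞) ≤ G.τ N ω) : gain G n t ω = 0 := by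
  have h1 : (t : ℝ≥0∞) ≤ G.τ n ω := hN.trans (tau_mono G ω h)
  have h2 : (t : ℝ≥0∞) ≤ G.τ (n + 1) ω := h1.trans (G.mono n ω)
  simp [gain, clip, min_eq_right h1, min_eq_right h2]

lemma elemCapital_eq (G : ElemStrategy) (c : ℝ) (N : ℕ) (ω : Omega) (t : ℝ≥0)
    (hN : (t : ℝ≥0∞) ≤ G.τ N ω) :
    elemCapital G c t ω = c + ∑ n ∈ Finset.range N, gain G n t ω := by
  unfold elemCapital
  congr 1
  refine tsum_eq_sum (f := fun n => gain G n t ω) fun n hn => ?_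
  refine gain_eq_zero G (N := N) ?_ ω t hN
  simpa using hn

lemma partial_eq (G : ElemStrategy) (c : ℝ) (N : ℕ) (ω : Omega) (t : ℝ≥0) :
    c + ∑ n ∈ Finset.range N, gain G n t ω = elemCapital G c (clip (G.τ N) t ω) ω := by
  rw [elemCapital_eq G c N ω]
  · congr 1
    refine Finset.sum_congr rfl fun n hn => ?_
    have hn' : n + 1 ≤ N := Finset.mem_range.1 hn
    have key : ∀ k ≤ N, clip (G.τ k) (clip (G.τ N) t ω) ω = clip (G.τ k) t ω := by
      intro k hk
      rw [← ENNReal.coe_inj, coe_clip, coe_clip, coe_clip, ← min_assoc,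
        min_eq_left (tau_mono G ω hk)]
    unfold gain
    rw [key n (by omega), key (n + 1) hn']
  · rw [coe_clip]; exact min_le_left _ _

lemma IsModel.capital (M : IsModel P Φ Y) (G : ElemStrategy) (c : ℝ)
    (hG : ∀ t ω, 0 ≤ elemCapital G c t ω) :
    AEMeasurable (fun z => ENNReal.ofReal (elemCapital G c 1 (Φ z))) P ∧
    ∫⁻ z, ENNReal.ofReal (elemCapital G c 1 (Φ z)) ∂P ≤ ENNReal.ofReal c := by
  set p : ℕ → S → ℝ := fun N z => c + ∑ n ∈ Finset.range N, gain G n 1 (Φ z) with hp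
  have hpI : ∀ N, Integrable (p N) P := fun N =>
    (integrable_const c).add (integrable_finsetSum _ fun n _ => (M.gain_int G n).1)
  have hpE : ∀ N, ∫ z, p N z ∂P = c := by
    intro N
    simp only [hp]
    rw [integral_add (integrable_const c)
      (integrable_finsetSum _ fun n _ => (M.gain_int G n).1),
      integral_finsetSum _ fun n _ => (M.gain_int G n).1]
    simp [(M.gain_int G _).2]
  have hp0 : ∀ N z, 0 ≤ p N z := fun N z => by
    simp only [hp]; rw [partial_eq]; exact hG _ _
  have hev : ∀ z, ∀ᶠ N in atTop, p N z = elemCapital G c 1 (Φ z) := by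
    intro z
    have := (G.tendsto_top (Φ z)).eventually (lt_mem_nhds (ENNReal.coe_lt_top (r := 1)))
    filter_upwards [this] with N hN
    rw [elemCapital_eq G c N (Φ z) 1 hN.le]
  have hlim : ∀ z, Tendsto (fun N => ENNReal.ofReal (p N z)) atTop
      (𝓝 (ENNReal.ofReal (elemCapital G c 1 (Φ z)))) := fun z =>
    tendsto_const_nhds.congr' ((hev z).mono fun N hN => by simp only [hN])
  have hpm : ∀ N, AEMeasurable (fun z => ENNReal.ofReal (p N z)) P := fun N =>
    (hpI N).aestronglyMeasurable.aemeasurable.ennreal_ofReal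
  refine ⟨aemeasurable_of_tendsto_metrizable_ae atTop hpm (Eventually.of_forall hlim), ?_⟩
  calc ∫⁻ z, ENNReal.ofReal (elemCapital G c 1 (Φ z)) ∂P
      = ∫⁻ z, liminf (fun N => ENNReal.ofReal (p N z)) atTop ∂P := by
        refine lintegral_congr fun z => ?_
        exact (hlim z).liminf_eq.symm
    _ ≤ liminf (fun N => ∫⁻ z, ENNReal.ofReal (p N z) ∂P) atTop :=
        lintegral_liminf_le' hpm
    _ = ENNReal.ofReal c := by
        have : ∀ N, ∫⁻ z, ENNReal.ofReal (p N z) ∂P = ENNReal.ofReal c := fun N => by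
          rw [← ofReal_integral_eq_lintegral_ofReal (hpI N) (Eventually.of_forall (hp0 N)), hpE]
        simp [this]

lemma IsModel.capital_const (M : IsModel P Φ Y) (G : ElemStrategy) (c : ℝ) (z : S) (t : ℝ≥0)
    (ht : 1 ≤ t) : elemCapital G c t (Φ z) = elemCapital G c 1 (Φ z) := by
  have key : ∀ τ : Omega → ℝ≥0∞, (Φ z).1 (clip τ t (Φ z)) = (Φ z).1 (clip τ 1 (Φ z)) := by
    intro τ
    rcases le_total (τ (Φ z)) 1 with h | h
    · have h' : τ (Φ z) ≤ (t : ℝ≥0∞) := h.trans (by exact_mod_cast ht)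
      simp [clip, min_eq_left h, min_eq_left h']
    · have h1 : clip τ 1 (Φ z) = 1 := by simp [clip, min_eq_right h]
      rw [h1]
      refine M.const z _ ?_
      rw [← ENNReal.coe_le_coe, coe_clip]
      exact le_min (by simpa using h) (by exact_mod_cast ht)
  unfold elemCapital
  simp only [key]

lemma IsModel.lower (M : IsModel P Φ Y) :
    1 ≤ UpProb {ω : Omega | ∀ s t : ℝ≥0, ω.1 s = ω.1 t}ᶜ := by
  unfold UpProb
  refine le_iInf fun C => le_iInf fun hC => ?_
  have h1 : ∀ᵐ z ∂P, 1 ≤ C.value 1 (Φ z) := by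
    filter_upwards [M.nonconst] with z hz
    have h2 := hC (Φ z)
    rw [Set.indicator_of_mem (by
      simp only [Set.mem_compl_iff, Set.mem_ofPred_eq]
      exact fun h => hz (h 0 1))] at h2
    have h3 : Tendsto (fun t : ℝ≥0 => C.value t (Φ z)) atTop (𝓝 (C.value 1 (Φ z))) := by
      refine tendsto_const_nhds.congr' ?_
      filter_upwards [eventually_ge_atTop 1] with t ht
      unfold PosCapital.value
      simp only [M.capital_const _ _ z t ht]
    rwa [h3.liminf_eq] at h2
  calc (1 : ℝ≥0∞) = ∫⁻ _, 1 ∂P := by simp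
    _ ≤ ∫⁻ z, C.value 1 (Φ z) ∂P := lintegral_mono_ae h1
    _ = ∑' n, ∫⁻ z, ENNReal.ofReal (elemCapital (C.G n) (C.c n) 1 (Φ z)) ∂P :=
        lintegral_tsum fun n => (M.capital (C.G n) (C.c n) (C.nonneg n)).1
    _ ≤ C.init := ENNReal.tsum_le_tsum fun n => (M.capital (C.G n) (C.c n) (C.nonneg n)).2

end

lemma UpProb_le_one (E : Set Omega) : UpProb E ≤ 1 := by
  let G : ElemStrategy :=
    { τ := fun n _ => (n : ℝ≥0∞)
      stopping := fun n t => MeasurableSet.const _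
      mono := fun n ω => by push_cast; exact le_self_add
      tendsto_top := fun ω => ENNReal.tendsto_nat_nhds_top
      h := fun _ _ => 0
      h_bdd := fun n => ⟨0, by simp⟩
      h_meas := fun n B hB t =>
        (@measurable_const ℝ Omega _ (F t) 0 B hB).inter (MeasurableSet.const _) }
  have hG : ∀ c t ω, elemCapital G c t ω = c := by
    intro c t ω; simp [elemCapital, G]
  let C : PosCapital :=
    { G := fun _ => G
      c := fun n => 1 / 2 / 2 ^ n
      c_pos := fun n => by positivity
      c_summable := summable_geometric_two' 1
      nonneg := fun n t ω => by rw [hG]; positivity }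
  have hi : C.init = 1 := by
    unfold PosCapital.init
    rw [← ENNReal.ofReal_tsum_of_nonneg (fun n => (C.c_pos n).le) C.c_summable]
    rw [show (∑' n, C.c n) = 1 from tsum_geometric_two' 1]
    simp
  have hv : ∀ t ω, C.value t ω = 1 := by
    intro t ω
    rw [← hi]
    unfold PosCapital.value PosCapital.init
    simp only [C, hG]
  unfold UpProb
  refine iInf_le_of_le C (iInf_le_of_le (fun ω => ?_) hi.le)
  simp only [hv, liminf_const]
  exact Set.indicator_le_self' (fun _ _ => zero_le) ω |>.trans le_rfl

lemma UpProb_const : 1 ≤ UpProb {ω : Omega | ∀ s t : ℝ≥0, ω.1 s = ω.1 t} := by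
  unfold UpProb
  refine le_iInf fun C => le_iInf fun hC => ?_
  let ω : Omega := ⟨fun _ => 0, continuous_const⟩
  have h := hC ω
  rw [Set.indicator_of_mem (by intro s t; rfl)] at h
  have : ∀ t, C.value t ω = C.init := by
    intro t
    unfold PosCapital.value PosCapital.init elemCapital
    simp [ω]
  simpa [this] using h


/-! ### Part B: Lévy's construction of Brownian motion on the unit interval -/

/-- The tent function. -/
noncomputable def phi (x : ℝ) : ℝ := max 0 (min x (1 - x))

lemma phi_nonneg (x : ℝ) : 0 ≤ phi x := le_max_left _ _

lemma phi_continuous : Continuous phi := by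
  unfold phi
  fun_prop

lemma phi_zero_of_le {x : ℝ} (h : x ≤ 0) : phi x = 0 := by
  unfold phi
  exact max_eq_left ((min_le_left _ _).trans h)

lemma phi_zero_of_ge {x : ℝ} (h : 1 ≤ x) : phi x = 0 := by
  unfold phi
  exact max_eq_left ((min_le_right _ _).trans (by linarith))

lemma phi_left {x : ℝ} (h : 0 ≤ x) (h' : x ≤ 1 / 2) : phi x = x := by
  unfold phi
  rw [min_eq_left (by linarith), max_eq_right h]

lemma phi_right {x : ℝ} (h : 1 / 2 ≤ x) (h' : x ≤ 1) : phi x = 1 - x := by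
  unfold phi
  rw [min_eq_right (by linarith), max_eq_right (by linarith)]

lemma phi_nat_sub (a k : ℕ) : phi ((a : ℝ) - k) = 0 := by
  rcases le_or_gt a k with h | h
  · exact phi_zero_of_le (by have : (a : ℝ) ≤ k := by exact_mod_cast h
                             linarith)
  · exact phi_zero_of_ge (by have : (k : ℝ) + 1 ≤ a := by exact_mod_cast h
                             linarith)

lemma phi_le_sub (x : ℝ) : phi x ≤ max 0 (min x 1) - max 0 (min (x - 1) 1) := by
  unfold phi
  simp only [max_def, min_def]
  split_ifs <;> linarith

lemma sum_phi_le (x : ℝ) (K : ℕ) : ∑ k ∈ Finset.range K, phi (x - k) ≤ 1 := by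
  have h : ∀ k ∈ Finset.range K, phi (x - k) ≤
      max 0 (min (x - k) 1) - max 0 (min (x - (k + 1 : ℕ)) 1) := by
    intro k _
    refine (phi_le_sub _).trans (le_of_eq ?_)
    push_cast
    ring_nf
  refine (Finset.sum_le_sum h).trans ?_
  rw [Finset.sum_range_sub' (fun k : ℕ => max 0 (min (x - k) 1))]
  have h1 : max 0 (min (x - (0 : ℕ)) 1) ≤ 1 := max_le zero_le_one (min_le_right _ _)
  have h2 : 0 ≤ max 0 (min (x - (K : ℕ)) 1) := le_max_left _ _
  linarith

/-- The Brownian bridge kernel, extended by zero. -/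
noncomputable def GG (s t : ℝ) : ℝ := max 0 (min s t) * max 0 (1 - max s t)

lemma GG_comm (s t : ℝ) : GG s t = GG t s := by
  unfold GG
  rw [min_comm, max_comm s t]

lemma GG_of_le {s t : ℝ} (h : s ≤ t) : GG s t = max 0 s * max 0 (1 - t) := by
  unfold GG
  rw [min_eq_left h, max_eq_right h]

lemma GG_step_aux {s t : ℝ} (h : s ≤ t) :
    GG s t = phi s * phi t + (GG (2 * s) (2 * t) + GG (2 * s - 1) (2 * t - 1)) / 2 := by
  rw [GG_of_le h, GG_of_le (by linarith), GG_of_le (by linarith)]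
  rcases le_total s 0 with h0 | h0
  · rw [max_eq_left h0, max_eq_left (by linarith : 2 * s ≤ 0),
      max_eq_left (by linarith : 2 * s - 1 ≤ 0), phi_zero_of_le h0]
    ring
  rcases le_total 1 t with h1 | h1
  · rw [max_eq_left (by linarith : 1 - t ≤ 0), max_eq_left (by linarith : 1 - 2 * t ≤ 0),
      max_eq_left (by linarith : 1 - (2 * t - 1) ≤ 0), phi_zero_of_ge h1]
    ring
  rw [max_eq_right h0, max_eq_right (by linarith : 0 ≤ 1 - t),
    max_eq_right (by linarith : 0 ≤ 2 * s), max_eq_right (by linarith : 0 ≤ 1 - (2 * t - 1))]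
  rcases le_total t (1 / 2) with h2 | h2
  · rw [max_eq_left (by linarith : 2 * s - 1 ≤ 0), max_eq_right (by linarith : 0 ≤ 1 - 2 * t),
      phi_left h0 (by linarith), phi_left (by linarith) h2]
    ring
  rw [max_eq_left (by linarith : 1 - 2 * t ≤ 0), phi_right h2 h1]
  rcases le_total s (1 / 2) with h3 | h3
  · rw [max_eq_left (by linarith : 2 * s - 1 ≤ 0), phi_left h0 h3]
    ring
  · rw [max_eq_right (by linarith : 0 ≤ 2 * s - 1), phi_right h3 (by linarith)]
    ring

lemma GG_step (s t : ℝ) :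
    GG s t = phi s * phi t + (GG (2 * s) (2 * t) + GG (2 * s - 1) (2 * t - 1)) / 2 := by
  rcases le_total s t with h | h
  · exact GG_step_aux h
  · rw [GG_comm s, GG_comm (2 * s), GG_comm (2 * s - 1), mul_comm (phi s)]
    exact GG_step_aux h

lemma sum_range_double (f : ℕ → ℝ) (K : ℕ) :
    ∑ k ∈ Finset.range (2 * K), f k = ∑ k ∈ Finset.range K, (f (2 * k) + f (2 * k + 1)) := by
  induction K with
  | zero => simp
  | succ K ih =>
    rw [show 2 * (K + 1) = 2 * K + 1 + 1 by ring, Finset.sum_range_succ, Finset.sum_range_succ, ih,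
      Finset.sum_range_succ]
    ring

lemma GG_expand (s t : ℝ) (N : ℕ) :
    GG s t = ∑ n ∈ Finset.range N, (1 / 2 : ℝ) ^ n *
        ∑ k ∈ Finset.range (2 ^ n), phi (2 ^ n * s - k) * phi (2 ^ n * t - k) +
      (1 / 2 : ℝ) ^ N * ∑ k ∈ Finset.range (2 ^ N), GG (2 ^ N * s - k) (2 ^ N * t - k) := by
  induction N with
  | zero => simp
  | succ N ih =>
    rw [ih, Finset.sum_range_succ, add_assoc]
    congr 1
    rw [pow_succ 2 N, mul_comm (2 ^ N) 2, sum_range_double, pow_succ (1 / 2 : ℝ) N, mul_assoc,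
      ← mul_add]
    congr 1
    rw [Finset.mul_sum, ← Finset.sum_add_distrib]
    refine Finset.sum_congr rfl fun k _ => ?_
    rw [GG_step]
    push_cast
    ring_nf

lemma GG_nat_sub (a k : ℕ) (t : ℝ) : GG ((a : ℝ) - k) t = 0 := by
  unfold GG
  rcases le_or_gt a k with h | h
  · have : (a : ℝ) ≤ k := by exact_mod_cast h
    rw [max_eq_left ((min_le_left _ _).trans (by linarith)), zero_mul]
  · have : (k : ℝ) + 1 ≤ a := by exact_mod_cast h
    have h2 := le_max_left ((a : ℝ) - k) t
    rw [max_eq_left (a := (0 : ℝ)) (b := 1 - _) (by linarith), mul_zero]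

lemma GG_dyadic {s : ℝ} (t : ℝ) {N a : ℕ} (h : 2 ^ N * s = a) :
    GG s t = ∑ n ∈ Finset.range N, (1 / 2 : ℝ) ^ n *
        ∑ k ∈ Finset.range (2 ^ n), phi (2 ^ n * s - k) * phi (2 ^ n * t - k) := by
  rw [GG_expand s t N, h, Finset.sum_eq_zero (s := Finset.range (2 ^ N))
    (fun k _ => GG_nat_sub a k _), mul_zero, add_zero]

/-- A fourth root of one half. -/
noncomputable def aa : ℝ := √(√(1 / 2))

lemma aa_four : aa ^ 4 = 1 / 2 := by
  unfold aa
  rw [show (4 : ℕ) = 2 * 2 from rfl, pow_mul, Real.sq_sqrt (by positivity),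
    Real.sq_sqrt (by positivity)]

lemma aa_pos : 0 < aa := by unfold aa; positivity

lemma aa_lt_one : aa < 1 := by
  by_contra h
  have := one_le_pow₀ (not_lt.1 h) (n := 4)
  rw [aa_four] at this
  norm_num at this

abbrev Ix : Type := Option (Σ n : ℕ, Fin (2 ^ n))

noncomputable def coef (t : ℝ) : Ix → ℝ
  | none => t
  | some ⟨n, k⟩ => aa ^ (2 * n) * phi (2 ^ n * t - (k : ℕ))

def IN (N : ℕ) : Finset Ix := Finset.insertNone ((Finset.range N).sigma fun _ => Finset.univ)

lemma sum_IN (N : ℕ) (f : Ix → ℝ) :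
    ∑ i ∈ IN N, f i = f none + ∑ n ∈ Finset.range N, ∑ k : Fin (2 ^ n), f (some ⟨n, k⟩) := by
  unfold IN
  rw [Finset.sum_insertNone, Finset.sum_sigma]

lemma kernel {s t : ℝ} (hs : 0 ≤ s) (hs1 : s ≤ 1) (ht : 0 ≤ t) (ht1 : t ≤ 1) {N a : ℕ}
    (h : 2 ^ N * s = a) : ∑ i ∈ IN N, coef s i * coef t i = min s t := by
  have h1 : ∑ i ∈ IN N, coef s i * coef t i = s * t + GG s t := by
    rw [sum_IN, GG_dyadic t h]
    simp only [coef]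
    congr 1
    refine Finset.sum_congr rfl fun n _ => ?_
    rw [Finset.mul_sum, ← Fin.sum_univ_eq_sum_range
      (fun k : ℕ => (1 / 2 : ℝ) ^ n * (phi (2 ^ n * s - k) * phi (2 ^ n * t - k)))]
    refine Finset.sum_congr rfl fun k _ => ?_
    rw [← aa_four]
    ring
  rw [h1]
  rcases le_total s t with hst | hst
  · rw [GG_of_le hst, max_eq_right hs, max_eq_right (by linarith), min_eq_left hst]
    ring
  · rw [GG_comm, GG_of_le hst, max_eq_right ht, max_eq_right (by linarith), min_eq_right hst]
    ring

noncomputable def lev (n : ℕ) (t : ℝ) (z : Ix → ℝ) : ℝ :=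
  ∑ k : Fin (2 ^ n), coef t (some ⟨n, k⟩) * z (some ⟨n, k⟩)

noncomputable def ybound (n : ℕ) (z : Ix → ℝ) : ℝ :=
  aa ^ n * (1 + aa ^ (4 * n) * ∑ k : Fin (2 ^ n), z (some ⟨n, k⟩) ^ 4)

lemma ybound_nonneg (n : ℕ) (z : Ix → ℝ) : 0 ≤ ybound n z := by
  have := aa_pos
  unfold ybound
  have : 0 ≤ ∑ k : Fin (2 ^ n), z (some ⟨n, k⟩) ^ 4 := Finset.sum_nonneg fun k _ => by positivity
  positivity

lemma abs_lev_le (n : ℕ) (t : ℝ) (z : Ix → ℝ) : |lev n t z| ≤ ybound n z := by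
  have ha := aa_pos
  set T := ∑ k : Fin (2 ^ n), z (some ⟨n, k⟩) ^ 4 with hT
  have hz : ∀ k : Fin (2 ^ n), aa ^ n * |z (some ⟨n, k⟩)| ≤ 1 + aa ^ (4 * n) * T := by
    intro k
    have h1 : z (some ⟨n, k⟩) ^ 4 ≤ T :=
      Finset.single_le_sum (f := fun k : Fin (2 ^ n) => z (some ⟨n, k⟩) ^ 4)
        (fun k _ => by positivity) (Finset.mem_univ k)
    have h2 : aa ^ (4 * n) * z (some ⟨n, k⟩) ^ 4 ≤ aa ^ (4 * n) * T := by gcongr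
    have h3 : aa ^ (4 * n) * z (some ⟨n, k⟩) ^ 4 = (aa ^ n * |z (some ⟨n, k⟩)|) ^ 4 := by
      rw [mul_pow, ← pow_mul, mul_comm n 4, ← abs_pow, abs_of_nonneg (by positivity)]
    rw [h3] at h2
    set y := aa ^ n * |z (some ⟨n, k⟩)|
    nlinarith [sq_nonneg (y ^ 2 - 1 / 2), sq_nonneg (y - 1 / 2)]
  unfold lev
  refine (Finset.abs_sum_le_sum_abs _ _).trans ?_
  have h4 : ∀ k ∈ (Finset.univ : Finset (Fin (2 ^ n))),
      |coef t (some ⟨n, k⟩) * z (some ⟨n, k⟩)| ≤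
        phi (2 ^ n * t - (k : ℕ)) * (aa ^ n * (1 + aa ^ (4 * n) * T)) := by
    intro k _
    simp only [coef]
    rw [abs_mul, abs_of_nonneg (mul_nonneg (by positivity) (phi_nonneg _))]
    calc _ = phi (2 ^ n * t - (k : ℕ)) * (aa ^ n * (aa ^ n * |z (some ⟨n, k⟩)|)) := by ring
      _ ≤ _ := by
        gcongr
        · exact phi_nonneg _
        · exact hz k
  refine (Finset.sum_le_sum h4).trans ?_
  rw [← Finset.sum_mul, Fin.sum_univ_eq_sum_range (fun k : ℕ => phi (2 ^ n * t - k))]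
  have h5 := sum_phi_le (2 ^ n * t) (2 ^ n)
  have h6 := ybound_nonneg n z
  unfold ybound at h6 ⊢
  nlinarith

lemma lev_dyadic {n N a : ℕ} (hn : N ≤ n) {t : ℝ} (h : 2 ^ N * t = a) (z : Ix → ℝ) :
    lev n t z = 0 := by
  unfold lev
  refine Finset.sum_eq_zero fun k _ => ?_
  have h1 : (2 : ℝ) ^ n * t = ((2 ^ (n - N) * a : ℕ) : ℝ) := by
    push_cast
    rw [← h, ← mul_assoc, ← pow_add]
    congr 3
    omega
  simp only [coef, h1, phi_nat_sub, mul_zero, zero_mul]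

lemma lev_continuous (n : ℕ) (z : Ix → ℝ) : Continuous fun t => lev n t z := by
  unfold lev
  simp only [coef]
  refine continuous_finsetSum _ fun k _ => ?_
  exact (continuous_const.mul (phi_continuous.comp (by fun_prop))).mul continuous_const


open ProbabilityTheory

noncomputable def mu : Measure (Ix → ℝ) := Measure.infinitePi fun _ : Ix => gaussianReal 0 1

instance : IsProbabilityMeasure mu := by unfold mu; infer_instance

lemma integrable_fourth (i : Ix) : Integrable (fun z : Ix → ℝ => z i ^ 4) mu := by
  have h : Integrable (fun x : ℝ => x ^ 4) (gaussianReal 0 1) := by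
    have h1 := (memLp_id_gaussianReal (μ := 0) (v := 1) 4).integrable_norm_pow (p := 4) (by norm_num)
    refine h1.congr (Eventually.of_forall fun x => ?_)
    simp only [id, Real.norm_eq_abs, ← abs_pow]
    exact abs_of_nonneg (by positivity)
  exact (measurePreserving_eval_infinitePi (fun _ : Ix => gaussianReal 0 1) i).integrable_comp_of_integrable h

noncomputable def M4 : ℝ := ∫ x, x ^ 4 ∂(gaussianReal 0 1)

lemma integral_fourth (i : Ix) : ∫ z : Ix → ℝ, z i ^ 4 ∂mu = M4 := by
  have h := measurePreserving_eval_infinitePi (fun _ : Ix => gaussianReal 0 1) i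
  have h2 : ∫ x, x ^ 4 ∂(Measure.map (Function.eval i) mu) = ∫ z : Ix → ℝ, z i ^ 4 ∂mu :=
    integral_map h.measurable.aemeasurable (by fun_prop)
  rw [← h2]
  unfold mu M4
  rw [h.map_eq]

lemma integrable_ybound (n : ℕ) : Integrable (ybound n) mu := by
  unfold ybound
  refine Integrable.const_mul ((integrable_const _).add (Integrable.const_mul ?_ _)) _
  exact integrable_finsetSum _ fun k _ => integrable_fourth _

lemma integral_ybound (n : ℕ) : ∫ z, ybound n z ∂mu = aa ^ n * (1 + M4) := by
  unfold ybound
  rw [integral_const_mul, integral_add (integrable_const _)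
    (Integrable.const_mul (integrable_finsetSum _ fun k _ => integrable_fourth _) _),
    integral_const_mul, integral_finsetSum _ fun k _ => integrable_fourth _]
  simp only [integral_fourth, integral_const, Finset.sum_const, Finset.card_univ, Fintype.card_fin]
  rw [pow_mul, aa_four]
  simp only [nsmul_eq_mul, probReal_univ, smul_eq_mul, one_mul]
  push_cast
  rw [← mul_assoc, ← mul_pow]
  norm_num

lemma M4_nonneg : 0 ≤ M4 := integral_nonneg fun x => by positivity

lemma ybound_measurable (n : ℕ) : Measurable (ybound n) := by
  unfold ybound
  fun_prop

lemma lintegral_tsum_ybound : ∫⁻ z, ∑' n, ENNReal.ofReal (ybound n z) ∂mu ≠ ⊤ := by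
  rw [lintegral_tsum fun n => (ybound_measurable n).ennreal_ofReal.aemeasurable]
  have h : ∀ n, ∫⁻ z, ENNReal.ofReal (ybound n z) ∂mu = ENNReal.ofReal (aa ^ n * (1 + M4)) := by
    intro n
    rw [← integral_ybound, ofReal_integral_eq_lintegral_ofReal (integrable_ybound n)
      (Eventually.of_forall fun z => ybound_nonneg n z)]
  simp only [h]
  refine Summable.tsum_ofReal_ne_top ?_
  exact (summable_geometric_of_lt_one aa_pos.le aa_lt_one).mul_right _

def good : Set (Ix → ℝ) := {z | ∑' n, ENNReal.ofReal (ybound n z) ≠ ⊤}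

lemma tsum_meas : Measurable fun z => ∑' n, ENNReal.ofReal (ybound n z) :=
  Measurable.ennreal_tsum fun n => (ybound_measurable n).ennreal_ofReal

lemma good_meas : MeasurableSet good := by
  unfold good
  exact (measurableSet_eq_fun tsum_meas measurable_const).compl

lemma good_ae : ∀ᵐ z ∂mu, z ∈ good := by
  filter_upwards [ae_lt_top tsum_meas lintegral_tsum_ybound] with z hz
  exact hz.ne

lemma good_summable {z : Ix → ℝ} (hz : z ∈ good) : Summable fun n => ybound n z := by
  have h := ENNReal.summable_toReal hz
  refine h.congr fun n => ?_
  rw [ENNReal.toReal_ofReal (ybound_nonneg n z)]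

noncomputable def Q : Measure good := mu.comap Subtype.val

lemma Q_map : Q.map (Subtype.val : good → Ix → ℝ) = mu := by
  unfold Q
  rw [map_comap_subtype_coe good_meas]
  exact Measure.restrict_eq_self_of_ae_mem good_ae

lemma Q_mp : MeasurePreserving (Subtype.val : good → Ix → ℝ) Q mu :=
  ⟨measurable_subtype_coe, Q_map⟩

instance : IsProbabilityMeasure Q := by
  refine ⟨?_⟩
  have := Q_mp.measure_preimage (s := Set.univ) MeasurableSet.univ.nullMeasurableSet
  simpa using this

/-- The path on `[0,1]`. -/
noncomputable def Bm (z : good) (t : ℝ) : ℝ := z.1 none * t + ∑' n, lev n t z.1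

lemma Bm_continuous (z : good) : Continuous (Bm z) := by
  unfold Bm
  refine (continuous_const.mul continuous_id).add ?_
  exact continuous_tsum (fun n => lev_continuous n z.1) (good_summable z.2)
    (fun n t => abs_lev_le n t z.1)

lemma lev_summable (z : good) (t : ℝ) : Summable fun n => lev n t z.1 :=
  Summable.of_norm_bounded (good_summable z.2) fun n => abs_lev_le n t z.1

noncomputable def Yb (z : good) : ℝ := |z.1 none| + ∑' n, ybound n z.1

lemma Bm_bound (z : good) {t : ℝ} (h0 : 0 ≤ t) (h1 : t ≤ 1) : |Bm z t| ≤ Yb z := by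
  unfold Bm Yb
  refine (abs_add_le _ _).trans (add_le_add ?_ ?_)
  · rw [abs_mul, abs_of_nonneg h0]
    exact mul_le_of_le_one_right (abs_nonneg _) h1
  · exact tsum_of_norm_bounded (f := fun n => lev n t z.1) (good_summable z.2).hasSum
      fun n => abs_lev_le n t z.1

lemma Zc_law (i : Ix) : HasLaw (fun z : good => z.1 i) (gaussianReal 0 1) Q := by
  have h := (measurePreserving_eval_infinitePi (fun _ : Ix => gaussianReal 0 1) i).comp Q_mp
  exact ⟨h.measurable.aemeasurable, h.map_eq⟩

lemma Zc_meas (i : Ix) : Measurable fun z : good => z.1 i :=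
  (measurable_pi_apply i).comp measurable_subtype_coe

lemma Zc_indep : iIndepFun (fun (i : Ix) (z : good) => z.1 i) Q := by
  rw [iIndepFun_iff_map_fun_eq_infinitePi_map (fun i => Zc_meas i)]
  simp only [(Zc_law _).map_eq]
  exact Q_map

lemma Zc_memLp (i : Ix) : MemLp (fun z : good => z.1 i) 2 Q := by
  have h := (memLp_id_gaussianReal (μ := 0) (v := 1) 2)
  rw [← (Zc_law i).map_eq] at h
  exact h.comp_of_map (Zc_law i).aemeasurable

lemma Zc_mean (i : Ix) : ∫ z : good, z.1 i ∂Q = 0 := by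
  rw [(Zc_law i).integral_eq]
  exact integral_id_gaussianReal

lemma Zc_cov (i j : Ix) :
    cov[fun z : good => z.1 i, fun z : good => z.1 j; Q] = if i = j then 1 else 0 := by
  split_ifs with h
  · subst h
    rw [covariance_self (Zc_law i).aemeasurable, (Zc_law i).variance_eq]
    simp
  · exact (Zc_indep.indepFun h).covariance_eq_zero (Zc_memLp i) (Zc_memLp j)

lemma Zc_gauss : IsGaussianProcess (fun (i : Ix) (z : good) => z.1 i) Q := by
  refine ⟨fun I => ?_⟩
  refine iIndepFun.hasGaussianLaw (X := fun (i : I) (z : good) => z.1 i) (fun i => ?_) ?_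
  · exact ⟨by rw [(Zc_law i).map_eq]; infer_instance⟩
  · exact Zc_indep.precomp Subtype.val_injective

lemma Bm_dyadic (z : good) {t : ℝ} {N a : ℕ} (h : 2 ^ N * t = a) :
    Bm z t = ∑ i ∈ IN N, coef t i * z.1 i := by
  rw [sum_IN]
  unfold Bm
  rw [tsum_eq_sum (s := Finset.range N) fun n hn => lev_dyadic (by simpa using hn) h z.1]
  simp only [coef, lev]
  ring

lemma Bm_meas (t : ℝ) : Measurable fun z => Bm z t := by
  unfold Bm
  refine Measurable.add ((Zc_meas none).mul_const t) ?_
  refine measurable_of_tendsto_metrizable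
    (f := fun (N : ℕ) (z : good) => ∑ n ∈ Finset.range N, lev n t z.1) (fun N => ?_) ?_
  · unfold lev
    exact Finset.measurable_sum _ fun n _ => Finset.measurable_sum _ fun k _ =>
      (Zc_meas _).const_mul _
  · rw [tendsto_pi_nhds]
    intro z
    exact (lev_summable z t).hasSum.tendsto_sum_nat

lemma dyadic_up {t : ℝ} {N a : ℕ} (h : 2 ^ N * t = a) {M : ℕ} (hM : N ≤ M) :
    ∃ b : ℕ, 2 ^ M * t = b := by
  refine ⟨2 ^ (M - N) * a, ?_⟩
  push_cast
  rw [← h, ← mul_assoc, ← pow_add]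
  congr 2
  omega

lemma Bm_cov {s t : ℝ} (hs : 0 ≤ s) (hs1 : s ≤ 1) (ht : 0 ≤ t) (ht1 : t ≤ 1) {N a b : ℕ}
    (h : 2 ^ N * s = a) (h' : 2 ^ N * t = b) :
    cov[fun z => Bm z s, fun z => Bm z t; Q] = min s t := by
  simp only [Bm_dyadic _ h, Bm_dyadic _ h']
  rw [covariance_fun_sum_fun_sum' (fun i _ => (Zc_memLp i).const_mul _)
    (fun i _ => (Zc_memLp i).const_mul _)]
  simp only [covariance_const_mul_left, covariance_const_mul_right, Zc_cov]
  rw [← kernel hs hs1 ht ht1 h]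
  refine Finset.sum_congr rfl fun i hi => ?_
  simp [hi, mul_comm]

lemma Bm_memLp {t : ℝ} {N a : ℕ} (h : 2 ^ N * t = a) : MemLp (fun z => Bm z t) 2 Q := by
  simp only [Bm_dyadic _ h]
  exact memLp_finsetSum _ fun i _ => (Zc_memLp i).const_mul _

lemma Bm_mean {t : ℝ} {N a : ℕ} (h : 2 ^ N * t = a) : ∫ z, Bm z t ∂Q = 0 := by
  simp only [Bm_dyadic _ h]
  rw [integral_finsetSum _ fun i _ => ((Zc_memLp i).const_mul _).integrable (by norm_num)]
  refine Finset.sum_eq_zero fun i _ => ?_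
  rw [integral_const_mul, Zc_mean, mul_zero]

lemma linear_ex (I : Finset Ix) (c : Ix → ℝ) (W : good → ℝ)
    (hW : ∀ z, W z = ∑ i ∈ I, c i * z.1 i) :
    ∃ I : Finset Ix, ∃ L : (I → ℝ) →L[ℝ] ℝ, ∀ z : good, W z = L (I.restrict (fun i => z.1 i)) := by
  refine ⟨I, ∑ i : I, c i • ContinuousLinearMap.proj i, fun z => ?_⟩
  rw [hW]
  simp only [ContinuousLinearMap.sum_apply, ContinuousLinearMap.smul_apply,
    ContinuousLinearMap.proj_apply, smul_eq_mul, Finset.restrict]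
  exact (Finset.sum_coe_sort I fun i => c i * z.1 i).symm

def Dy (s : ℝ) : Type := {d : ℕ × ℕ // (d.2 : ℝ) / 2 ^ d.1 ≤ s}

lemma dy_eq (d : ℕ × ℕ) : (2 : ℝ) ^ d.1 * ((d.2 : ℝ) / 2 ^ d.1) = (d.2 : ℕ) := by
  field_simp

lemma Bm_indep {s t : ℝ} (hs : 0 ≤ s) (hst : s ≤ t) (ht1 : t ≤ 1) {N a b : ℕ}
    (h : 2 ^ N * s = a) (h' : 2 ^ N * t = b) :
    IndepFun (fun z (d : Dy s) => Bm z ((d.1.2 : ℝ) / 2 ^ d.1.1))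
      (fun z (_ : Unit) => Bm z t - Bm z s) Q := by
  refine IsGaussianProcess.indepFun_of_covariance_eq_zero
    (X := fun (d : Dy s) z => Bm z ((d.1.2 : ℝ) / 2 ^ d.1.1))
    (Y := fun (_ : Unit) z => Bm z t - Bm z s) ?_
    (fun d => (Bm_meas _).aemeasurable) (fun _ => ((Bm_meas _).sub (Bm_meas _)).aemeasurable) ?_
  · refine Zc_gauss.of_isGaussianProcess ?_
    rintro (d | _)
    · exact linear_ex _ _ _ fun z => Bm_dyadic z (dy_eq d.1)
    · refine linear_ex (IN N) (fun i => coef t i - coef s i) _ fun z => ?_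
      simp only [Sum.elim_inr, Bm_dyadic _ h, Bm_dyadic _ h']
      rw [← Finset.sum_sub_distrib]
      exact Finset.sum_congr rfl fun i _ => by ring
  · intro d _
    set r : ℝ := (d.1.2 : ℝ) / 2 ^ d.1.1 with hr
    have hr0 : 0 ≤ r := by positivity
    have hrs : r ≤ s := d.2
    rw [covariance_fun_sub_right (Bm_memLp (dy_eq d.1)) (Bm_memLp h') (Bm_memLp h)]
    obtain ⟨r', h1⟩ := dyadic_up (dy_eq d.1) (le_max_left d.1.1 N)
    obtain ⟨a', h2⟩ := dyadic_up h (le_max_right d.1.1 N)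
    obtain ⟨b', h3⟩ := dyadic_up h' (le_max_right d.1.1 N)
    rw [Bm_cov hr0 (by linarith) (by linarith) ht1 h1 h3,
      Bm_cov hr0 (by linarith) hs (by linarith) h1 h2, min_eq_left hrs, min_eq_left (by linarith),
      sub_self]

/-- The path as an element of `Omega`. -/
noncomputable def Ph (z : good) : Omega :=
  ⟨fun r => Bm z ((min r 1 : ℝ≥0) : ℝ), (Bm_continuous z).comp (by fun_prop)⟩

lemma Ph_apply (z : good) (r : ℝ≥0) : (Ph z).1 r = Bm z ((min r 1 : ℝ≥0) : ℝ) := rfl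

lemma meas_F {S : Type} (m0 : MeasurableSpace S) {Ψ : S → Omega} {s : ℝ≥0}
    (h : ∀ r ≤ s, Measurable[m0] fun z => (Ψ z).1 r) : @Measurable S Omega m0 (F s) Ψ := by
  rw [measurable_iff_comap_le]
  unfold F
  rw [MeasurableSpace.comap_iSup]
  refine iSup_le fun r => ?_
  rw [MeasurableSpace.comap_comp]
  exact (h r.1 r.2).comap_le

lemma Bm_approx {s r : ℝ} (hr0 : 0 ≤ r) (hr : r ≤ s) :
    Measurable[MeasurableSpace.comap (fun z (d : Dy s) => Bm z ((d.1.2 : ℝ) / 2 ^ d.1.1))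
      inferInstance] fun z => Bm z r := by
  have hlim : Tendsto (fun m : ℕ => ((⌊r * 2 ^ m⌋₊ : ℝ) / 2 ^ m)) atTop (𝓝 r) :=
    (tendsto_nat_floor_mul_div_atTop hr0).comp
      (tendsto_pow_atTop_atTop_of_one_lt (by norm_num : (1 : ℝ) < 2))
  refine @measurable_of_tendsto_metrizable _ _ (_) _ _ _ _
    (fun (m : ℕ) z => Bm z ((⌊r * 2 ^ m⌋₊ : ℝ) / 2 ^ m)) _ (fun m => ?_) ?_
  · have hd : ((⌊r * 2 ^ m⌋₊ : ℕ) : ℝ) / 2 ^ m ≤ s := by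
      refine le_trans ?_ hr
      rw [div_le_iff₀ (by positivity)]
      exact Nat.floor_le (by positivity)
    have h1 := comap_measurable (m := (inferInstance : MeasurableSpace (Dy s → ℝ)))
      (fun z (d : Dy s) => Bm z ((d.1.2 : ℝ) / 2 ^ d.1.1))
    exact (measurable_pi_apply (⟨(m, ⌊r * 2 ^ m⌋₊), hd⟩ : Dy s)).comp h1
  · rw [tendsto_pi_nhds]
    intro z
    exact ((Bm_continuous z).tendsto r).comp hlim

lemma model : IsModel Q Ph Yb where
  const z t ht := by
    rw [Ph_apply, Ph_apply, min_eq_right ht, min_self]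
  meas := meas_F _ fun r _ => Bm_meas _
  int := by
    refine Integrable.add ((Zc_memLp none).integrable (by norm_num)).abs ?_
    have h : Integrable (fun z : Ix → ℝ => (∑' n, ENNReal.ofReal (ybound n z)).toReal) mu :=
      integrable_toReal_of_lintegral_ne_top tsum_meas.aemeasurable lintegral_tsum_ybound
    refine (Q_mp.integrable_comp_of_integrable h).congr (Eventually.of_forall fun z => ?_)
    simp only [Function.comp]
    rw [ENNReal.tsum_toReal_eq fun n => ENNReal.ofReal_ne_top]
    exact tsum_congr fun n => ENNReal.toReal_ofReal (ybound_nonneg n z.1)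
  bound z t := by
    rw [Ph_apply]
    refine Bm_bound z (NNReal.coe_nonneg _) ?_
    exact_mod_cast min_le_right t 1
  nonconst := by
    have h0 : ∀ z, (Ph z).1 0 = 0 := by
      intro z
      rw [Ph_apply, Bm_dyadic z (N := 0) (a := 0) (by simp), sum_IN]
      simp [coef]
    have h1 : ∀ z, (Ph z).1 1 = z.1 none := by
      intro z
      rw [Ph_apply, Bm_dyadic z (N := 0) (a := 1) (by simp), sum_IN]
      simp [coef]
    have := nullSingletonClass_gaussianReal (μ := 0) (v := 1) one_ne_zero
    have h2 : ∀ᵐ x ∂(gaussianReal 0 1), (0 : ℝ) ≠ x := by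
      rw [ae_iff]
      simp
    rw [← (Zc_law none).map_eq] at h2
    have h3 := ae_of_ae_map (Zc_law none).aemeasurable h2
    filter_upwards [h3] with z hz
    rw [h0, h1]
    exact hz
  mart m j hj g hg hC := by
    set s : ℝ≥0 := (j : ℝ≥0) / 2 ^ m with hsd
    set t : ℝ≥0 := ((j + 1 : ℕ) : ℝ≥0) / 2 ^ m with htd
    have hst : s ≤ t := by
      rw [hsd, htd]
      gcongr
      omega
    have ht1 : t ≤ 1 := by
      rw [htd, div_le_one (by positivity)]
      exact_mod_cast hj
    have es : (2 : ℝ) ^ m * (s : ℝ) = (j : ℕ) := by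
      rw [hsd]; push_cast; field_simp
    have et : (2 : ℝ) ^ m * (t : ℝ) = ((j + 1 : ℕ) : ℝ) := by
      rw [htd]; push_cast; field_simp
    have hind := Bm_indep (NNReal.coe_nonneg s) (NNReal.coe_le_coe.2 hst)
      (by exact_mod_cast ht1) es et
    rw [IndepFun_iff_Indep] at hind
    have hPs : ∀ r ≤ s, Measurable[MeasurableSpace.comap
        (fun z (d : Dy s) => Bm z ((d.1.2 : ℝ) / 2 ^ d.1.1)) inferInstance]
        fun z => (Ph z).1 r := by
      intro r hr
      simp only [Ph_apply, min_eq_left (hr.trans (hst.trans ht1))]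
      exact Bm_approx (NNReal.coe_nonneg r) (by exact_mod_cast hr)
    have hgm := (hg.comp (meas_F _ hPs))
    have hgi : IndepFun (fun z => g (Ph z)) (fun z => Bm z t - Bm z s) Q := by
      rw [IndepFun_iff_Indep]
      refine indep_of_indep_of_le_left (indep_of_indep_of_le_right hind ?_) hgm.comap_le
      have h1 := comap_measurable (m := (inferInstance : MeasurableSpace (Unit → ℝ)))
        (fun (z : good) (_ : Unit) => Bm z t - Bm z s)
      exact ((measurable_pi_apply ()).comp h1).comap_le
    simp only [Ph_apply, min_eq_left ht1, min_eq_left (hst.trans ht1)]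
    have hgm' : Measurable fun z => g (Ph z) :=
      hg.comp (meas_F _ fun r _ => Bm_meas _)
    rw [hgi.integral_fun_mul_eq_mul_integral hgm'.aestronglyMeasurable
      ((Bm_meas _).sub (Bm_meas _)).aestronglyMeasurable,
      integral_sub ((Bm_memLp et).integrable (by norm_num)) ((Bm_memLp es).integrable (by norm_num)),
      Bm_mean et, Bm_mean es]
    simp

/-- the event that `ω` is constant on `[0,∞)` is completely
uncertain. -/
theorem constant_completely_uncertain :
    UpProb {ω : Omega | ∀ s t : ℝ≥0, ω.1 s = ω.1 t} = 1 ∧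
      UpProb {ω : Omega | ∀ s t : ℝ≥0, ω.1 s = ω.1 t}ᶜ = 1 := by
  exact ⟨le_antisymm (UpProb_le_one _) UpProb_const, le_antisymm (UpProb_le_one _) model.lower⟩

end GTP
end
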